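/- arXiv:math/0111040 — 4 statements merged into one kernel-verified Lean document; each statement's English description precedes it below -/
import Mathlib

section
/- Let K be an algebraically closed field with char K ≠ 2. Let q₁, q₂, q₃ be three ternary quadratic forms over K with Plücker brackets [ijk] as defined in the context. Let M be the 8×8 matrix over K whose rows are: Row 1: (0, [245], [345], [135], [045], [035], [145], [235]); Row 2: (−[245], 0, −[235], [035], [025], [015], [125], −[125]+[045]); Row 3: (−[345], [235], 0, [134], [035], [034], [135], [234]); Row 4: (−[135], −[035], −[134], 0, [023], [013], [123]−[034], −[123]); Row 5: (−[045], −[025], −[035], −[023], 0, [012], −[015], −[024]+[015]); Row 6: (−[035], −[015], −[034], −[013], −[012], 0, [023]−[014], −[023]); Row 7: (−[145], −[125], −[135], −[123]+[034], [015], −[023]+[014], 0, −[124]+[035]); Row 8: (−[235], [125]−[045], −[234], [123], [024]−[015], [023], [124]−[035], 0). Then det M = 0 if and only if there exists (x,y,z) ∈ K³ with (x,y,z) ≠ (0,0,0) and q₁(x,y,z) = q₂(x,y,z) = q₃(x,y,z) = 0. (The matrix M is alternating and its Pfaffian is the resultant of the three quadrics; here the square of that statement is expressed via the determinant.) -/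
/-- A ternary quadratic form `u₀x² + u₁xy + u₂xz + u₃y² + u₄yz + u₅z²` with
coefficient vector `u` indexed by the monomials `x², xy, xz, y², yz, z²`. -/
def ternaryQuad {K : Type*} [CommRing K] (u : Fin 6 → K) (x y z : K) : K :=
  u 0 * x ^ 2 + u 1 * (x * y) + u 2 * (x * z) + u 3 * y ^ 2 + u 4 * (y * z) + u 5 * z ^ 2

/-- The Plücker bracket `[ijk]`: the determinant of the 3×3 submatrix of the 3×6
coefficient matrix `u` formed by columns `i`, `j`, `k`. -/
def pluckerBracket {K : Type*} [CommRing K] (u : Fin 3 → Fin 6 → K) (i j k : Fin 6) : K :=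
  Matrix.det !![u 0 i, u 0 j, u 0 k; u 1 i, u 1 j, u 1 k; u 2 i, u 2 j, u 2 k]

open scoped Matrix

/-- The 8×8 alternating matrix of linear forms in the Plücker coordinates `P`. -/
def pfaffianMatrix {K : Type*} [CommRing K] (P : Fin 6 → Fin 6 → Fin 6 → K) :
    Matrix (Fin 8) (Fin 8) K :=
  !![0,        P 2 4 5,            P 3 4 5,  P 1 3 5,            P 0 4 5,            P 0 3 5,            P 1 4 5,            P 2 3 5;
    -P 2 4 5,  0,                 -P 2 3 5,  P 0 3 5,            P 0 2 5,            P 0 1 5,            P 1 2 5,           -P 1 2 5 + P 0 4 5;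
    -P 3 4 5,  P 2 3 5,            0,        P 1 3 4,            P 0 3 5,            P 0 3 4,            P 1 3 5,            P 2 3 4;
    -P 1 3 5, -P 0 3 5,           -P 1 3 4,  0,                  P 0 2 3,            P 0 1 3,            P 1 2 3 - P 0 3 4, -P 1 2 3;
    -P 0 4 5, -P 0 2 5,           -P 0 3 5, -P 0 2 3,            0,                  P 0 1 2,           -P 0 1 5,           -P 0 2 4 + P 0 1 5;
    -P 0 3 5, -P 0 1 5,           -P 0 3 4, -P 0 1 3,           -P 0 1 2,            0,                  P 0 2 3 - P 0 1 4, -P 0 2 3;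
    -P 1 4 5, -P 1 2 5,           -P 1 3 5, -P 1 2 3 + P 0 3 4,  P 0 1 5,           -P 0 2 3 + P 0 1 4,  0,                 -P 1 2 4 + P 0 3 5;
    -P 2 3 5,  P 1 2 5 - P 0 4 5, -P 2 3 4,  P 1 2 3,            P 0 2 4 - P 0 1 5,  P 0 2 3,            P 1 2 4 - P 0 3 5,  0]

/-- The polar form `q(p + r) - q(p) - q(r)` of a ternary quadratic form. -/
def ternaryPolar {K : Type*} [CommRing K] (u : Fin 6 → K) (p r : Fin 3 → K) : K :=
  2 * u 0 * p 0 * r 0 + u 1 * (p 0 * r 1 + p 1 * r 0) + u 2 * (p 0 * r 2 + p 2 * r 0) +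
    2 * u 3 * p 1 * r 1 + u 4 * (p 1 * r 2 + p 2 * r 1) + 2 * u 5 * p 2 * r 2

/-- The coefficient vector of the quadratic form `v ↦ q(g v)`. -/
def quadSubst {K : Type*} [CommRing K] (g : Matrix (Fin 3) (Fin 3) K) (u : Fin 6 → K) :
    Fin 6 → K :=
  ![ternaryQuad u (g 0 0) (g 1 0) (g 2 0), ternaryPolar u (gᵀ 0) (gᵀ 1),
    ternaryPolar u (gᵀ 0) (gᵀ 2), ternaryQuad u (g 0 1) (g 1 1) (g 2 1),
    ternaryPolar u (gᵀ 1) (gᵀ 2), ternaryQuad u (g 0 2) (g 1 2) (g 2 2)]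

section Covariance

variable {K : Type*} [CommRing K]

theorem ternaryQuad_quadSubst (g : Matrix (Fin 3) (Fin 3) K) (u : Fin 6 → K) (p : Fin 3 → K) :
    ternaryQuad (quadSubst g u) (p 0) (p 1) (p 2) =
      ternaryQuad u ((g *ᵥ p) 0) ((g *ᵥ p) 1) ((g *ᵥ p) 2) := by
  simp [quadSubst, ternaryQuad, ternaryPolar, Matrix.mulVec, dotProduct, Fin.sum_univ_three]
  ring

theorem quadSubst_quadSubst (g h : Matrix (Fin 3) (Fin 3) K) (u : Fin 6 → K) :
    quadSubst h (quadSubst g u) = quadSubst (g * h) u := by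
  ext i
  fin_cases i <;>
  · simp [quadSubst, ternaryQuad, ternaryPolar, Matrix.mul_apply, Fin.sum_univ_three]
    ring

theorem quadSubst_one (u : Fin 6 → K) : quadSubst 1 u = u := by
  ext i
  fin_cases i <;> simp [quadSubst, ternaryQuad, ternaryPolar]

theorem pluckerBracket_eq (u : Fin 3 → Fin 6 → K) (i j k : Fin 6) :
    pluckerBracket u i j k =
      u 0 i * (u 1 j * u 2 k - u 1 k * u 2 j) - u 0 j * (u 1 i * u 2 k - u 1 k * u 2 i) +
        u 0 k * (u 1 i * u 2 j - u 1 j * u 2 i) := by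
  simp [pluckerBracket, Matrix.det_fin_three]
  ring

theorem pluckerBracket_mul (h : Matrix (Fin 3) (Fin 3) K) (u : Matrix (Fin 3) (Fin 6) K) :
    pluckerBracket (h * u) = fun i j k ↦ h.det * pluckerBracket u i j k := by
  ext i j k
  simp only [pluckerBracket, ← Matrix.det_mul]
  congr 1
  ext a b
  fin_cases a <;> fin_cases b <;> simp [Matrix.mul_apply, Fin.sum_univ_three]

theorem pfaffianMatrix_smul (c : K) (P : Fin 6 → Fin 6 → Fin 6 → K) :
    pfaffianMatrix (fun i j k ↦ c * P i j k) = c • pfaffianMatrix P := by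
  ext i j
  fin_cases i <;> fin_cases j <;> simp [pfaffianMatrix] <;> ring

theorem quadSubst_diagonal (d : Fin 3 → K) (v : Fin 6 → K) :
    quadSubst (Matrix.diagonal d) v =
      ![d 0 ^ 2, d 0 * d 1, d 0 * d 2, d 1 ^ 2, d 1 * d 2, d 2 ^ 2] * v := by
  ext i
  fin_cases i <;> simp [quadSubst, ternaryQuad, ternaryPolar] <;> ring

theorem pluckerBracket_mul_left (w : Fin 6 → K) (u : Fin 3 → Fin 6 → K) (i j k : Fin 6) :
    pluckerBracket (fun m ↦ w * u m) i j k = w i * w j * w k * pluckerBracket u i j k := by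
  simp only [pluckerBracket_eq, Pi.mul_apply]
  ring

theorem pfaffianMatrix_quadSubst_diagonal (d : Fin 3 → K) (u : Fin 3 → Fin 6 → K) :
    pfaffianMatrix (pluckerBracket fun m ↦ quadSubst (Matrix.diagonal d) (u m)) =
      let D := Matrix.diagonal ![d 1 * d 2 ^ 2, d 0 * d 2 ^ 2, d 1 ^ 2 * d 2, d 0 * d 1 ^ 2,
        d 0 ^ 2 * d 2, d 0 ^ 2 * d 1, d 0 * d 1 * d 2, d 0 * d 1 * d 2]
      D * pfaffianMatrix (pluckerBracket u) * D := by
  simp only [quadSubst_diagonal]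
  ext i j
  simp only [Matrix.diagonal_mul, Matrix.mul_diagonal]
  fin_cases i <;> fin_cases j <;>
  · simp [pfaffianMatrix, pluckerBracket_mul_left]
    try ring

theorem pfaffianMatrix_mulVec (P : Fin 6 → Fin 6 → Fin 6 → K) (v : Fin 8 → K) :
    pfaffianMatrix P *ᵥ v =
      ![P 2 4 5 * v 1 + P 3 4 5 * v 2 + P 1 3 5 * v 3 + P 0 4 5 * v 4 + P 0 3 5 * v 5
          + P 1 4 5 * v 6 + P 2 3 5 * v 7,
        -P 2 4 5 * v 0 - P 2 3 5 * v 2 + P 0 3 5 * v 3 + P 0 2 5 * v 4 + P 0 1 5 * v 5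
          + P 1 2 5 * v 6 + (P 0 4 5 - P 1 2 5) * v 7,
        -P 3 4 5 * v 0 + P 2 3 5 * v 1 + P 1 3 4 * v 3 + P 0 3 5 * v 4 + P 0 3 4 * v 5
          + P 1 3 5 * v 6 + P 2 3 4 * v 7,
        -P 1 3 5 * v 0 - P 0 3 5 * v 1 - P 1 3 4 * v 2 + P 0 2 3 * v 4 + P 0 1 3 * v 5
          + (P 1 2 3 - P 0 3 4) * v 6 - P 1 2 3 * v 7,
        -P 0 4 5 * v 0 - P 0 2 5 * v 1 - P 0 3 5 * v 2 - P 0 2 3 * v 3 + P 0 1 2 * v 5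
          - P 0 1 5 * v 6 + (P 0 1 5 - P 0 2 4) * v 7,
        -P 0 3 5 * v 0 - P 0 1 5 * v 1 - P 0 3 4 * v 2 - P 0 1 3 * v 3 - P 0 1 2 * v 4
          + (P 0 2 3 - P 0 1 4) * v 6 - P 0 2 3 * v 7,
        -P 1 4 5 * v 0 - P 1 2 5 * v 1 - P 1 3 5 * v 2 + (P 0 3 4 - P 1 2 3) * v 3
          + P 0 1 5 * v 4 + (P 0 1 4 - P 0 2 3) * v 5 + (P 0 3 5 - P 1 2 4) * v 7,
        -P 2 3 5 * v 0 + (P 1 2 5 - P 0 4 5) * v 1 - P 2 3 4 * v 2 + P 1 2 3 * v 3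
          + (P 0 2 4 - P 0 1 5) * v 4 + P 0 2 3 * v 5 + (P 1 2 4 - P 0 3 5) * v 6] := by
  ext i
  fin_cases i <;>
  · simp [pfaffianMatrix, Matrix.mulVec, dotProduct, Fin.sum_univ_eight]
    try ring

theorem vec_eight_eq_zero_iff (a b c d e f g h : K) :
    (![a, b, c, d, e, f, g, h] : Fin 8 → K) = 0 ↔
      a = 0 ∧ b = 0 ∧ c = 0 ∧ d = 0 ∧ e = 0 ∧ f = 0 ∧ g = 0 ∧ h = 0 := by
  simp

end Covariance

section Field

variable {K : Type*} [Field K]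

theorem det_pfaffianMatrix_eq_zero_iff (P : Fin 6 → Fin 6 → Fin 6 → K) :
    (pfaffianMatrix P).det = 0 ↔ ∃ v ≠ 0, pfaffianMatrix P *ᵥ v = 0 :=
  Matrix.exists_mulVec_eq_zero_iff.symm

theorem det_pfaffianMatrix_quadSubst_transvection_0_1 (t : K) (u : Fin 3 → Fin 6 → K)
    (h : (pfaffianMatrix (pluckerBracket u)).det = 0) :
    (pfaffianMatrix (pluckerBracket
      fun m ↦ quadSubst (Matrix.transvection 0 1 t) (u m))).det = 0 := by
  rw [det_pfaffianMatrix_eq_zero_iff] at h ⊢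
  obtain ⟨v, hv, h⟩ := h
  simp only [pfaffianMatrix_mulVec, vec_eight_eq_zero_iff] at h
  obtain ⟨h0, h1, h2, h3, h4, h5, h6, h7⟩ := h
  refine ⟨![v 0, v 1 - t * v 0, v 2, v 3, v 4 + t ^ 2 * v 2 - 2 * t * v 6 + t * v 7, v 5 - t * v 3,
      v 6 - t * v 2, v 7], ?_, ?_⟩
  · contrapose! hv
    simp only [vec_eight_eq_zero_iff] at hv
    clear h0 h1 h2 h3 h4 h5 h6 h7
    obtain ⟨h0, h1, h2, h3, h4, h5, h6, h7⟩ := hv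
    ext i
    fin_cases i <;> simp_all
  · simp only [pfaffianMatrix_mulVec, vec_eight_eq_zero_iff]
    simp [pluckerBracket_eq, quadSubst, ternaryQuad, ternaryPolar, Matrix.transvection] at *
    refine ⟨?_, ?_, ?_, ?_, ?_, ?_, ?_, ?_⟩
    · linear_combination h0 + t * h1
    · linear_combination h1
    · linear_combination h2 + t ^ 2 * h4 + t * h6
    · linear_combination h3 + t * h5
    · linear_combination h4
    · linear_combination h5
    · linear_combination h6 + 2 * t * h4
    · linear_combination h7 - t * h4

theorem det_pfaffianMatrix_quadSubst_transvection_0_2 (t : K) (u : Fin 3 → Fin 6 → K)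
    (h : (pfaffianMatrix (pluckerBracket u)).det = 0) :
    (pfaffianMatrix (pluckerBracket
      fun m ↦ quadSubst (Matrix.transvection 0 2 t) (u m))).det = 0 := by
  rw [det_pfaffianMatrix_eq_zero_iff] at h ⊢
  obtain ⟨v, hv, h⟩ := h
  simp only [pfaffianMatrix_mulVec, vec_eight_eq_zero_iff] at h
  obtain ⟨h0, h1, h2, h3, h4, h5, h6, h7⟩ := h
  refine ⟨![v 0, v 1, v 2, v 3 + t * v 2, v 4 - t * v 1, v 5 - t ^ 2 * v 0 + t * v 6 - 2 * t * v 7,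
      v 6, v 7 + t * v 0], ?_, ?_⟩
  · contrapose! hv
    simp only [vec_eight_eq_zero_iff] at hv
    clear h0 h1 h2 h3 h4 h5 h6 h7
    obtain ⟨h0, h1, h2, h3, h4, h5, h6, h7⟩ := hv
    ext i
    fin_cases i <;> simp_all
  · simp only [pfaffianMatrix_mulVec, vec_eight_eq_zero_iff]
    simp [pluckerBracket_eq, quadSubst, ternaryQuad, ternaryPolar, Matrix.transvection] at *
    refine ⟨?_, ?_, ?_, ?_, ?_, ?_, ?_, ?_⟩
    · linear_combination h0 - t ^ 2 * h5 - t * h7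
    · linear_combination h1 + t * h4
    · linear_combination h2 - t * h3
    · linear_combination h3
    · linear_combination h4
    · linear_combination h5
    · linear_combination h6 - t * h5
    · linear_combination h7 + 2 * t * h5

theorem det_pfaffianMatrix_quadSubst_transvection_1_0 (t : K) (u : Fin 3 → Fin 6 → K)
    (h : (pfaffianMatrix (pluckerBracket u)).det = 0) :
    (pfaffianMatrix (pluckerBracket
      fun m ↦ quadSubst (Matrix.transvection 1 0 t) (u m))).det = 0 := by
  rw [det_pfaffianMatrix_eq_zero_iff] at h ⊢
  obtain ⟨v, hv, h⟩ := h
  simp only [pfaffianMatrix_mulVec, vec_eight_eq_zero_iff] at h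
  obtain ⟨h0, h1, h2, h3, h4, h5, h6, h7⟩ := h
  refine ⟨![v 0 - t * v 1, v 1, v 2 + t ^ 2 * v 4 - 2 * t * v 6 + t * v 7, v 3 - t * v 5, v 4, v 5,
      v 6 - t * v 4, v 7], ?_, ?_⟩
  · contrapose! hv
    simp only [vec_eight_eq_zero_iff] at hv
    clear h0 h1 h2 h3 h4 h5 h6 h7
    obtain ⟨h0, h1, h2, h3, h4, h5, h6, h7⟩ := hv
    ext i
    fin_cases i <;> simp_all
  · simp only [pfaffianMatrix_mulVec, vec_eight_eq_zero_iff]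
    simp [pluckerBracket_eq, quadSubst, ternaryQuad, ternaryPolar, Matrix.transvection] at *
    refine ⟨?_, ?_, ?_, ?_, ?_, ?_, ?_, ?_⟩
    · linear_combination h0
    · linear_combination h1 + t * h0
    · linear_combination h2
    · linear_combination h3
    · linear_combination h4 + t ^ 2 * h2 + t * h6
    · linear_combination h5 + t * h3
    · linear_combination h6 + 2 * t * h2
    · linear_combination h7 - t * h2

theorem det_pfaffianMatrix_quadSubst_transvection_1_2 (t : K) (u : Fin 3 → Fin 6 → K)
    (h : (pfaffianMatrix (pluckerBracket u)).det = 0) :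
    (pfaffianMatrix (pluckerBracket
      fun m ↦ quadSubst (Matrix.transvection 1 2 t) (u m))).det = 0 := by
  rw [det_pfaffianMatrix_eq_zero_iff] at h ⊢
  obtain ⟨v, hv, h⟩ := h
  simp only [pfaffianMatrix_mulVec, vec_eight_eq_zero_iff] at h
  obtain ⟨h0, h1, h2, h3, h4, h5, h6, h7⟩ := h
  refine ⟨![v 0, v 1, v 2 - t * v 0, v 3 + t ^ 2 * v 1 - t * v 6 - t * v 7, v 4, v 5 - t * v 4, v 6
      - t * v 1, v 7 - t * v 1], ?_, ?_⟩
  · contrapose! hv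
    simp only [vec_eight_eq_zero_iff] at hv
    clear h0 h1 h2 h3 h4 h5 h6 h7
    obtain ⟨h0, h1, h2, h3, h4, h5, h6, h7⟩ := hv
    ext i
    fin_cases i <;> simp_all
  · simp only [pfaffianMatrix_mulVec, vec_eight_eq_zero_iff]
    simp [pluckerBracket_eq, quadSubst, ternaryQuad, ternaryPolar, Matrix.transvection] at *
    refine ⟨?_, ?_, ?_, ?_, ?_, ?_, ?_, ?_⟩
    · linear_combination h0 + t * h2
    · linear_combination h1 + t ^ 2 * h3 + t * h6 + t * h7
    · linear_combination h2
    · linear_combination h3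
    · linear_combination h4 + t * h5
    · linear_combination h5
    · linear_combination h6 + t * h3
    · linear_combination h7 + t * h3

theorem det_pfaffianMatrix_quadSubst_transvection_2_0 (t : K) (u : Fin 3 → Fin 6 → K)
    (h : (pfaffianMatrix (pluckerBracket u)).det = 0) :
    (pfaffianMatrix (pluckerBracket
      fun m ↦ quadSubst (Matrix.transvection 2 0 t) (u m))).det = 0 := by
  rw [det_pfaffianMatrix_eq_zero_iff] at h ⊢
  obtain ⟨v, hv, h⟩ := h
  simp only [pfaffianMatrix_mulVec, vec_eight_eq_zero_iff] at h
  obtain ⟨h0, h1, h2, h3, h4, h5, h6, h7⟩ := h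
  refine ⟨![v 0 - t ^ 2 * v 5 - t * v 6 + 2 * t * v 7, v 1 - t * v 4, v 2 + t * v 3, v 3, v 4, v 5,
      v 6, v 7 - t * v 5], ?_, ?_⟩
  · contrapose! hv
    simp only [vec_eight_eq_zero_iff] at hv
    clear h0 h1 h2 h3 h4 h5 h6 h7
    obtain ⟨h0, h1, h2, h3, h4, h5, h6, h7⟩ := hv
    ext i
    fin_cases i <;> simp_all
  · simp only [pfaffianMatrix_mulVec, vec_eight_eq_zero_iff]
    simp [pluckerBracket_eq, quadSubst, ternaryQuad, ternaryPolar, Matrix.transvection] at *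
    refine ⟨?_, ?_, ?_, ?_, ?_, ?_, ?_, ?_⟩
    · linear_combination h0
    · linear_combination h1
    · linear_combination h2
    · linear_combination h3 - t * h2
    · linear_combination h4 + t * h1
    · linear_combination h5 - t ^ 2 * h0 + t * h7
    · linear_combination h6 + t * h0
    · linear_combination h7 - 2 * t * h0

theorem det_pfaffianMatrix_quadSubst_transvection_2_1 (t : K) (u : Fin 3 → Fin 6 → K)
    (h : (pfaffianMatrix (pluckerBracket u)).det = 0) :
    (pfaffianMatrix (pluckerBracket
      fun m ↦ quadSubst (Matrix.transvection 2 1 t) (u m))).det = 0 := by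
  rw [det_pfaffianMatrix_eq_zero_iff] at h ⊢
  obtain ⟨v, hv, h⟩ := h
  simp only [pfaffianMatrix_mulVec, vec_eight_eq_zero_iff] at h
  obtain ⟨h0, h1, h2, h3, h4, h5, h6, h7⟩ := h
  refine ⟨![v 0 - t * v 2, v 1 + t ^ 2 * v 3 - t * v 6 - t * v 7, v 2, v 3, v 4 - t * v 5, v 5, v 6
      - t * v 3, v 7 - t * v 3], ?_, ?_⟩
  · contrapose! hv
    simp only [vec_eight_eq_zero_iff] at hv
    clear h0 h1 h2 h3 h4 h5 h6 h7
    obtain ⟨h0, h1, h2, h3, h4, h5, h6, h7⟩ := hv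
    ext i
    fin_cases i <;> simp_all
  · simp only [pfaffianMatrix_mulVec, vec_eight_eq_zero_iff]
    simp [pluckerBracket_eq, quadSubst, ternaryQuad, ternaryPolar, Matrix.transvection] at *
    refine ⟨?_, ?_, ?_, ?_, ?_, ?_, ?_, ?_⟩
    · linear_combination h0
    · linear_combination h1
    · linear_combination h2 + t * h0
    · linear_combination h3 + t ^ 2 * h1 + t * h6 + t * h7
    · linear_combination h4
    · linear_combination h5 + t * h4
    · linear_combination h6 + t * h1
    · linear_combination h7 + t * h1

theorem det_pfaffianMatrix_quadSubst_diagonal (d : Fin 3 → K) (u : Fin 3 → Fin 6 → K)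
    (h : (pfaffianMatrix (pluckerBracket u)).det = 0) :
    (pfaffianMatrix (pluckerBracket fun m ↦ quadSubst (Matrix.diagonal d) (u m))).det = 0 := by
  simp [pfaffianMatrix_quadSubst_diagonal, Matrix.det_mul, h]

theorem det_pfaffianMatrix_quadSubst (g : Matrix (Fin 3) (Fin 3) K) (hg : g.det ≠ 0)
    (u : Fin 3 → Fin 6 → K) (h : (pfaffianMatrix (pluckerBracket u)).det = 0) :
    (pfaffianMatrix (pluckerBracket fun m ↦ quadSubst g (u m))).det = 0 := by
  refine Matrix.diagonal_transvection_induction_of_det_ne_zero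
    (fun g ↦ ∀ u : Fin 3 → Fin 6 → K, (pfaffianMatrix (pluckerBracket u)).det = 0 →
      (pfaffianMatrix (pluckerBracket fun m ↦ quadSubst g (u m))).det = 0)
    g hg (fun d _ ↦ det_pfaffianMatrix_quadSubst_diagonal d) ?_ ?_ u h
  · rintro ⟨i, j, hij, c⟩
    fin_cases i <;> fin_cases j <;> first | exact absurd rfl hij | skip
    · exact det_pfaffianMatrix_quadSubst_transvection_0_1 c
    · exact det_pfaffianMatrix_quadSubst_transvection_0_2 c
    · exact det_pfaffianMatrix_quadSubst_transvection_1_0 c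
    · exact det_pfaffianMatrix_quadSubst_transvection_1_2 c
    · exact det_pfaffianMatrix_quadSubst_transvection_2_0 c
    · exact det_pfaffianMatrix_quadSubst_transvection_2_1 c
  · intro A B _ _ hA hB u hu
    simpa only [quadSubst_quadSubst] using hB _ (hA u hu)

theorem det_pfaffianMatrix_of_quadSubst (g : Matrix (Fin 3) (Fin 3) K) (hg : g.det ≠ 0)
    (u : Fin 3 → Fin 6 → K)
    (h : (pfaffianMatrix (pluckerBracket fun m ↦ quadSubst g (u m))).det = 0) :
    (pfaffianMatrix (pluckerBracket u)).det = 0 := by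
  have hg' : g⁻¹.det ≠ 0 := by simpa [Matrix.det_nonsing_inv] using hg
  simpa [quadSubst_quadSubst, Matrix.mul_nonsing_inv g hg.isUnit, quadSubst_one] using
    det_pfaffianMatrix_quadSubst g⁻¹ hg' _ h

/-- The quadratic forms with coefficient vectors `u 0, u 1, u 2` share a nontrivial zero. -/
def HasCommonZero (u : Fin 3 → Fin 6 → K) : Prop :=
  ∃ p : Fin 3 → K, p ≠ 0 ∧ ∀ m, ternaryQuad (u m) (p 0) (p 1) (p 2) = 0

theorem mulVec_ne_zero {g : Matrix (Fin 3) (Fin 3) K} (hg : g.det ≠ 0) {p : Fin 3 → K}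
    (hp : p ≠ 0) : g *ᵥ p ≠ 0 :=
  fun h ↦ hp (Matrix.eq_zero_of_mulVec_eq_zero hg h)

theorem HasCommonZero.of_quadSubst {g : Matrix (Fin 3) (Fin 3) K} (hg : g.det ≠ 0)
    {u : Fin 3 → Fin 6 → K} (h : HasCommonZero fun m ↦ quadSubst g (u m)) :
    HasCommonZero u := by
  obtain ⟨p, hp, h⟩ := h
  exact ⟨g *ᵥ p, mulVec_ne_zero hg hp, fun m ↦ by rw [← ternaryQuad_quadSubst, h m]⟩

theorem HasCommonZero.of_mul {h : Matrix (Fin 3) (Fin 3) K} (hh : h.det ≠ 0)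
    {u : Matrix (Fin 3) (Fin 6) K} (H : HasCommonZero (h * u)) : HasCommonZero u := by
  obtain ⟨p, hp, H⟩ := H
  refine ⟨p, hp, fun m ↦ ?_⟩
  refine congrFun (Matrix.eq_zero_of_mulVec_eq_zero hh
    (v := fun m ↦ ternaryQuad (u m) (p 0) (p 1) (p 2)) ?_) m
  ext i
  rw [Pi.zero_apply, ← H i]
  simp [Matrix.mulVec, dotProduct, ternaryQuad, Matrix.mul_apply, Fin.sum_univ_three]
  ring

theorem exists_det_ne_zero_col_two_eq {p : Fin 3 → K} (hp : p ≠ 0) :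
    ∃ g : Matrix (Fin 3) (Fin 3) K, g.det ≠ 0 ∧ gᵀ 2 = p := by
  by_cases h2 : p 2 = 0
  · by_cases h1 : p 1 = 0
    · have h0 : p 0 ≠ 0 := fun h0 ↦ hp (by ext i; fin_cases i <;> simp_all)
      refine ⟨!![0, 0, p 0; 1, 0, p 1; 0, 1, p 2], by simpa [Matrix.det_fin_three] using h0, ?_⟩
      ext i; fin_cases i <;> rfl
    · refine ⟨!![1, 0, p 0; 0, 0, p 1; 0, 1, p 2], by simpa [Matrix.det_fin_three] using h1, ?_⟩
      ext i; fin_cases i <;> rfl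
  · refine ⟨!![1, 0, p 0; 0, 1, p 1; 0, 0, p 2], by simpa [Matrix.det_fin_three] using h2, ?_⟩
    ext i; fin_cases i <;> rfl

theorem HasCommonZero.det_pfaffianMatrix_eq_zero {u : Fin 3 → Fin 6 → K} (h : HasCommonZero u) :
    (pfaffianMatrix (pluckerBracket u)).det = 0 := by
  obtain ⟨p, hp, h⟩ := h
  obtain ⟨g, hg, rfl⟩ := exists_det_ne_zero_col_two_eq hp
  apply det_pfaffianMatrix_of_quadSubst g hg
  apply Matrix.det_eq_zero_of_row_eq_zero 0
  have h5 (m : Fin 3) : quadSubst g (u m) 5 = 0 := h m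
  intro j
  fin_cases j <;> simp [pfaffianMatrix, pluckerBracket_eq, h5]

/-- The symmetric matrix of the polar form of a ternary quadratic form. -/
def gramMatrix (u : Fin 6 → K) : Matrix (Fin 3) (Fin 3) K :=
  !![2 * u 0, u 1, u 2; u 1, 2 * u 3, u 4; u 2, u 4, 2 * u 5]

theorem eq_zero_and_eq_zero_of_det_ne_zero {a b c d x y : K} (hdet : a * d - b * c ≠ 0)
    (h1 : a * x + b * y = 0) (h2 : c * x + d * y = 0) : x = 0 ∧ y = 0 :=
  ⟨(mul_eq_zero_iff_left hdet).mp (by linear_combination d * h1 - b * h2),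
    (mul_eq_zero_iff_left hdet).mp (by linear_combination a * h2 - c * h1)⟩

section AlgClosed

variable [IsAlgClosed K]

theorem exists_binaryQuad_normal_form (h2 : (2 : K) ≠ 0) (a b c : K) :
    ∃ g : Matrix (Fin 3) (Fin 3) K, g.det ≠ 0 ∧ ∃ e,
      quadSubst g ![a, b, 0, c, 0, 0] = ![0, e, 0, 0, 0, 0] ∨
      quadSubst g ![a, b, 0, c, 0, 0] = ![e, 0, 0, 0, 0, 0] := by
  by_cases ha : a = 0
  · by_cases hb : b = 0
    · refine ⟨!![0, 1, 0; 1, 0, 0; 0, 0, 1], by simp [Matrix.det_fin_three], c, Or.inr ?_⟩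
      ext i
      fin_cases i <;> simp [quadSubst, ternaryQuad, ternaryPolar, ha, hb]
    · refine ⟨!![1, -c, 0; 0, b, 0; 0, 0, 1], by simpa [Matrix.det_fin_three] using hb,
        b * b, Or.inl ?_⟩
      ext i
      fin_cases i <;> simp [quadSubst, ternaryQuad, ternaryPolar, ha]
      ring
  · obtain ⟨s, hs⟩ := IsAlgClosed.exists_pow_nat_eq (b ^ 2 - 4 * a * c) two_pos
    by_cases h0 : s = 0
    · refine ⟨!![1, -b, 0; 0, 2 * a, 0; 0, 0, 1], by simp [Matrix.det_fin_three, ha, h2],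
        a, Or.inr ?_⟩
      subst h0
      ext i
      fin_cases i <;> simp [quadSubst, ternaryQuad, ternaryPolar]
      · ring
      · linear_combination a * hs
    · refine ⟨!![b + s, -b + s, 0; -2 * a, 2 * a, 0; 0, 0, 1], ?_, 4 * a * s ^ 2, Or.inl ?_⟩
      · have : (4 : K) * a * s ≠ 0 := by
          simp [show (4 : K) = 2 * 2 by norm_num, h2, ha, h0]
        convert this using 1
        simp [Matrix.det_fin_three]
        ring
      · ext i
        fin_cases i <;> simp [quadSubst, ternaryQuad, ternaryPolar]
        · linear_combination a * hs
        · linear_combination -2 * a * hs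
        · linear_combination a * hs

theorem exists_normal_form (h2 : (2 : K) ≠ 0) {u : Fin 6 → K} (hu : (gramMatrix u).det = 0) :
    ∃ g : Matrix (Fin 3) (Fin 3) K, g.det ≠ 0 ∧ ∃ e,
      quadSubst g u = ![0, e, 0, 0, 0, 0] ∨ quadSubst g u = ![e, 0, 0, 0, 0, 0] := by
  obtain ⟨v, hv, h⟩ := Matrix.exists_mulVec_eq_zero_iff.mpr hu
  obtain ⟨g, hg, rfl⟩ := exists_det_ne_zero_col_two_eq hv
  have hpolar (p : Fin 3 → K) : ternaryPolar u p (gᵀ 2) = 0 := by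
    have : p ⬝ᵥ (gramMatrix u *ᵥ gᵀ 2) = 0 := by rw [h, dotProduct_zero]
    rw [← this]
    simp [ternaryPolar, gramMatrix, Matrix.mulVec, dotProduct, Fin.sum_univ_three]
    ring
  have hquad : ternaryQuad u (g 0 2) (g 1 2) (g 2 2) = 0 := by
    refine (mul_eq_zero_iff_left h2).mp ?_
    rw [← hpolar (gᵀ 2)]
    simp [ternaryPolar, ternaryQuad]
    ring
  have hform : quadSubst g u =
      ![quadSubst g u 0, quadSubst g u 1, 0, quadSubst g u 3, 0, 0] := by
    ext i
    fin_cases i <;> first | rfl | simp [quadSubst, hpolar, hquad]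
  obtain ⟨g', hg', e, he⟩ := exists_binaryQuad_normal_form h2
    (quadSubst g u 0) (quadSubst g u 1) (quadSubst g u 3)
  rw [← hform, quadSubst_quadSubst] at he
  exact ⟨g * g', by simp [Matrix.det_mul, hg, hg'], e, he⟩

theorem exists_cubic_root {a : K} (ha : a ≠ 0) (b c d : K) :
    ∃ t, a * t ^ 3 + b * t ^ 2 + c * t + d = 0 := by
  open Polynomial in
  obtain ⟨t, ht⟩ := IsAlgClosed.exists_root (C a * X ^ 3 + C b * X ^ 2 + C c * X + C d)
    (by rw [degree_cubic ha]; decide)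
  exact ⟨t, by simpa [Polynomial.IsRoot] using ht⟩

theorem exists_quadratic_root {a : K} (ha : a ≠ 0) (b c : K) :
    ∃ t, a * t ^ 2 + b * t + c = 0 := by
  open Polynomial in
  obtain ⟨t, ht⟩ := IsAlgClosed.exists_root (C a * X ^ 2 + C b * X + C c)
    (by rw [degree_quadratic ha]; decide)
  exact ⟨t, by simpa [Polynomial.IsRoot] using ht⟩

/-- A pencil of conics contains a singular member. -/
theorem exists_gramMatrix_det_eq_zero (a b : Fin 6 → K) :
    (gramMatrix b).det = 0 ∨ ∃ t : K, (gramMatrix (a + t • b)).det = 0 := by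
  refine or_iff_not_imp_left.mpr fun hb ↦ ?_
  let D (x y : Fin 6 → K) : K :=
    8 * (x 0 * x 3 * y 5 + x 0 * y 3 * x 5 + y 0 * x 3 * x 5)
      + 2 * (x 1 * x 2 * y 4 + x 1 * y 2 * x 4 + y 1 * x 2 * x 4)
      - 2 * (y 0 * x 4 ^ 2 + 2 * x 0 * x 4 * y 4) - 2 * (y 3 * x 2 ^ 2 + 2 * x 3 * x 2 * y 2)
      - 2 * (y 5 * x 1 ^ 2 + 2 * x 5 * x 1 * y 1)
  obtain ⟨t, ht⟩ := exists_cubic_root hb (D b a) (D a b) (gramMatrix a).det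
  refine ⟨t, ?_⟩
  rw [← ht]
  simp [gramMatrix, Matrix.det_fin_three, D]
  ring

theorem exists_binaryQuad_zero (a b c : K) :
    ∃ y z : K, (y ≠ 0 ∨ z ≠ 0) ∧ a * y ^ 2 + b * (y * z) + c * z ^ 2 = 0 := by
  by_cases ha : a = 0
  · exact ⟨1, 0, by simp [ha]⟩
  · obtain ⟨t, ht⟩ := exists_quadratic_root ha b c
    exact ⟨t, 1, by simp, by linear_combination ht⟩

/-- Two binary quadratic forms with vanishing resultant have a common nontrivial zero. -/
theorem exists_binaryQuad_common_zero {a b c a' b' c' : K}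
    (h : (a * c' - c * a') ^ 2 = (a * b' - b * a') * (b * c' - c * b')) :
    ∃ y z : K, (y ≠ 0 ∨ z ≠ 0) ∧ a * y ^ 2 + b * (y * z) + c * z ^ 2 = 0 ∧
      a' * y ^ 2 + b' * (y * z) + c' * z ^ 2 = 0 := by
  by_cases ha : a = 0
  · subst ha
    by_cases ha' : a' = 0
    · exact ⟨1, 0, by simp [ha']⟩
    by_cases hb : b = 0
    · subst hb
      have hc : c = 0 := by simpa [ha'] using h
      obtain ⟨y, z, hyz, h'⟩ := exists_binaryQuad_zero a' b' c'
      exact ⟨y, z, hyz, by simp [hc], h'⟩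
    · refine ⟨-c, b, Or.inr hb, by ring, mul_left_cancel₀ ha' ?_⟩
      linear_combination h
  · obtain ⟨t, ht⟩ := exists_quadratic_root ha b c
    have key : (a' * t ^ 2 + b' * t + c') *
        (a' * (a * t + b) ^ 2 - b' * a * (a * t + b) + c' * a ^ 2) = 0 := by
      linear_combination h +
        (a' ^ 2 * (a * t ^ 2 + b * t - c) + a' * b' * b + 2 * a * a' * c' - a * b' ^ 2) * ht
    rcases mul_eq_zero.mp key with h' | h'
    · exact ⟨t, 1, by simp, by linear_combination ht, by linear_combination h'⟩
    · exact ⟨-(a * t + b), a, Or.inr ha, by linear_combination a ^ 2 * ht, by linear_combination h'⟩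

theorem exists_common_zero_of_gramMatrix_det_eq_zero (h2 : (2 : K) ≠ 0) {a : Fin 6 → K}
    (ha : (gramMatrix a).det = 0) (b : Fin 6 → K) :
    ∃ p : Fin 3 → K, p ≠ 0 ∧ ternaryQuad a (p 0) (p 1) (p 2) = 0 ∧
      ternaryQuad b (p 0) (p 1) (p 2) = 0 := by
  obtain ⟨g, hg, e, he⟩ := exists_normal_form h2 ha
  obtain ⟨y, z, hyz, h⟩ := exists_binaryQuad_zero (quadSubst g b 3) (quadSubst g b 4)
    (quadSubst g b 5)
  refine ⟨g *ᵥ ![0, y, z], mulVec_ne_zero hg (by simpa [imp_iff_not_or] using hyz), ?_, ?_⟩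
  · rw [← ternaryQuad_quadSubst]
    rcases he with he | he <;> simp [he, ternaryQuad]
  · rw [← ternaryQuad_quadSubst]
    simpa [ternaryQuad] using h

theorem exists_common_zero_of_two (h2 : (2 : K) ≠ 0) (a b : Fin 6 → K) :
    ∃ p : Fin 3 → K, p ≠ 0 ∧ ternaryQuad a (p 0) (p 1) (p 2) = 0 ∧
      ternaryQuad b (p 0) (p 1) (p 2) = 0 := by
  rcases exists_gramMatrix_det_eq_zero a b with hb | ⟨t, ht⟩
  · obtain ⟨p, hp, hb, ha⟩ := exists_common_zero_of_gramMatrix_det_eq_zero h2 hb a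
    exact ⟨p, hp, ha, hb⟩
  · obtain ⟨p, hp, ha, hb⟩ := exists_common_zero_of_gramMatrix_det_eq_zero h2 ht b
    refine ⟨p, hp, ?_, hb⟩
    have : ternaryQuad (a + t • b) (p 0) (p 1) (p 2) =
        ternaryQuad a (p 0) (p 1) (p 2) + t * ternaryQuad b (p 0) (p 1) (p 2) := by
      simp [ternaryQuad]
      ring
    rwa [this, hb, mul_zero, add_zero] at ha

theorem hasCommonZero_of_zero (h2 : (2 : K) ≠ 0) {u : Fin 3 → Fin 6 → K} (h0 : u 0 = 0) :
    HasCommonZero u := by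
  obtain ⟨p, hp, h1, h2⟩ := exists_common_zero_of_two h2 (u 1) (u 2)
  refine ⟨p, hp, fun m ↦ ?_⟩
  fin_cases m
  · simp [h0, ternaryQuad]
  · exact h1
  · exact h2

/-- A common zero on the line `x = 0`, when the first form vanishes there. -/
theorem hasCommonZero_of_resultant_x {u : Fin 3 → Fin 6 → K}
    (h3 : u 0 3 = 0) (h4 : u 0 4 = 0) (h5 : u 0 5 = 0)
    (h : (u 1 3 * u 2 5 - u 1 5 * u 2 3) ^ 2 =
      (u 1 3 * u 2 4 - u 1 4 * u 2 3) * (u 1 4 * u 2 5 - u 1 5 * u 2 4)) :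
    HasCommonZero u := by
  obtain ⟨y, z, hyz, e1, e2⟩ := exists_binaryQuad_common_zero h
  refine ⟨![0, y, z], by simpa [imp_iff_not_or] using hyz, fun m ↦ ?_⟩
  fin_cases m <;> simp [ternaryQuad, h3, h4, h5, e1, e2]

/-- A common zero on the line `y = 0`, when the first form vanishes there. -/
theorem hasCommonZero_of_resultant_y {u : Fin 3 → Fin 6 → K}
    (h0 : u 0 0 = 0) (h2 : u 0 2 = 0) (h5 : u 0 5 = 0)
    (h : (u 1 0 * u 2 5 - u 1 5 * u 2 0) ^ 2 =
      (u 1 0 * u 2 2 - u 1 2 * u 2 0) * (u 1 2 * u 2 5 - u 1 5 * u 2 2)) :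
    HasCommonZero u := by
  obtain ⟨x, z, hxz, e1, e2⟩ := exists_binaryQuad_common_zero h
  refine ⟨![x, 0, z], by simpa [imp_iff_not_or] using hxz, fun m ↦ ?_⟩
  fin_cases m <;> simp [ternaryQuad, h0, h2, h5, e1, e2]

theorem hasCommonZero_of_xy {u : Fin 3 → Fin 6 → K} {e : K} (he : e ≠ 0)
    (hu : u 0 = ![0, e, 0, 0, 0, 0]) (h : (pfaffianMatrix (pluckerBracket u)).det = 0) :
    HasCommonZero u := by
  by_contra hzero
  have hx := mt (hasCommonZero_of_resultant_x (by simp [hu]) (by simp [hu]) (by simp [hu])) hzero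
  have hy := mt (hasCommonZero_of_resultant_y (by simp [hu]) (by simp [hu]) (by simp [hu])) hzero
  rw [← sub_eq_zero] at hx hy
  obtain ⟨v, hv, h⟩ := (det_pfaffianMatrix_eq_zero_iff _).mp h
  simp [pfaffianMatrix_mulVec, pluckerBracket_eq, hu] at h
  obtain ⟨h0, h1, h2, h3, h4, h5, h6, h7⟩ := h
  have cancel {t : K} (ht : e * t = 0) : t = 0 := (mul_eq_zero_iff_left he).mp ht
  obtain ⟨v3, v6⟩ := eq_zero_and_eq_zero_of_det_ne_zero
    (a := (u 1 3 * u 2 5 - u 1 5 * u 2 3)) (b := (u 1 4 * u 2 5 - u 1 5 * u 2 4))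
    (c := (u 1 3 * u 2 4 - u 1 4 * u 2 3)) (d := (u 1 3 * u 2 5 - u 1 5 * u 2 3))
    (x := v 3) (y := v 6) (by contrapose! hx; linear_combination hx)
    (cancel (by linear_combination h0)) (cancel (by linear_combination h2))
  simp only [v3, v6] at h1 h3 h4 h5 h6 h7
  obtain ⟨v5, v7⟩ := eq_zero_and_eq_zero_of_det_ne_zero
    (a := (u 1 0 * u 2 5 - u 1 5 * u 2 0)) (b := (u 1 2 * u 2 5 - u 1 5 * u 2 2))
    (c := (u 1 0 * u 2 2 - u 1 2 * u 2 0)) (d := (u 1 0 * u 2 5 - u 1 5 * u 2 0))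
    (x := v 5) (y := v 7) (by contrapose! hy; linear_combination hy)
    (cancel (by linear_combination -h1)) (cancel (by linear_combination -h4))
  simp only [v5, v7] at h3 h6
  obtain ⟨v1, v4⟩ := eq_zero_and_eq_zero_of_det_ne_zero
    (a := (u 1 0 * u 2 5 - u 1 5 * u 2 0)) (b := (u 1 0 * u 2 2 - u 1 2 * u 2 0))
    (c := (u 1 2 * u 2 5 - u 1 5 * u 2 2)) (d := (u 1 0 * u 2 5 - u 1 5 * u 2 0))
    (x := v 1) (y := v 4) (by contrapose! hy; linear_combination hy)
    (cancel (by linear_combination h5)) (cancel (by linear_combination h7))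
  simp only [v1, v4] at h6
  obtain ⟨v0, v2⟩ := eq_zero_and_eq_zero_of_det_ne_zero
    (a := (u 1 3 * u 2 5 - u 1 5 * u 2 3)) (b := (u 1 3 * u 2 4 - u 1 4 * u 2 3))
    (c := (u 1 4 * u 2 5 - u 1 5 * u 2 4)) (d := (u 1 3 * u 2 5 - u 1 5 * u 2 3))
    (x := v 0) (y := v 2) (by contrapose! hx; linear_combination hx)
    (cancel (by linear_combination -h3)) (cancel (by linear_combination -h6))
  refine hv (funext fun i ↦ ?_)
  fin_cases i <;> assumption

theorem hasCommonZero_of_x_sq {u : Fin 3 → Fin 6 → K} {e : K} (he : e ≠ 0)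
    (hu : u 0 = ![e, 0, 0, 0, 0, 0]) (h : (pfaffianMatrix (pluckerBracket u)).det = 0) :
    HasCommonZero u := by
  by_contra hzero
  have hx := mt (hasCommonZero_of_resultant_x (by simp [hu]) (by simp [hu]) (by simp [hu])) hzero
  rw [← sub_eq_zero] at hx
  obtain ⟨v, hv, h⟩ := (det_pfaffianMatrix_eq_zero_iff _).mp h
  simp [pfaffianMatrix_mulVec, pluckerBracket_eq, hu] at h
  obtain ⟨h0, h1, h2, h3, h4, h5, h6, h7⟩ := h
  have cancel {t : K} (ht : e * t = 0) : t = 0 := (mul_eq_zero_iff_left he).mp ht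
  obtain ⟨v4, v5⟩ := eq_zero_and_eq_zero_of_det_ne_zero
    (a := (u 1 4 * u 2 5 - u 1 5 * u 2 4)) (b := (u 1 3 * u 2 5 - u 1 5 * u 2 3))
    (c := (u 1 3 * u 2 5 - u 1 5 * u 2 3)) (d := (u 1 3 * u 2 4 - u 1 4 * u 2 3))
    (x := v 4) (y := v 5) (by contrapose! hx; linear_combination -hx)
    (cancel (by linear_combination h0)) (cancel (by linear_combination h2))
  simp only [v4, v5] at h1 h3 h4 h5 h6 h7
  obtain ⟨v3, v7⟩ := eq_zero_and_eq_zero_of_det_ne_zero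
    (a := (u 1 3 * u 2 5 - u 1 5 * u 2 3)) (b := (u 1 4 * u 2 5 - u 1 5 * u 2 4))
    (c := (u 1 3 * u 2 4 - u 1 4 * u 2 3)) (d := (u 1 3 * u 2 5 - u 1 5 * u 2 3))
    (x := v 3) (y := v 7) (by contrapose! hx; linear_combination hx)
    (cancel (by linear_combination h1)) (cancel (by linear_combination h6))
  simp only [v3, v7] at h3 h4 h5 h7
  obtain ⟨v1, v6⟩ := eq_zero_and_eq_zero_of_det_ne_zero
    (a := (u 1 3 * u 2 5 - u 1 5 * u 2 3)) (b := (u 1 3 * u 2 4 - u 1 4 * u 2 3))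
    (c := (u 1 4 * u 2 5 - u 1 5 * u 2 4)) (d := (u 1 3 * u 2 5 - u 1 5 * u 2 3))
    (x := v 1) (y := v 6) (by contrapose! hx; linear_combination hx)
    (cancel (by linear_combination -h3)) (cancel (by linear_combination -h7))
  simp only [v1, v6] at h4 h5
  obtain ⟨v0, v2⟩ := eq_zero_and_eq_zero_of_det_ne_zero
    (a := (u 1 4 * u 2 5 - u 1 5 * u 2 4)) (b := (u 1 3 * u 2 5 - u 1 5 * u 2 3))
    (c := (u 1 3 * u 2 5 - u 1 5 * u 2 3)) (d := (u 1 3 * u 2 4 - u 1 4 * u 2 3))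
    (x := v 0) (y := v 2) (by contrapose! hx; linear_combination -hx)
    (cancel (by linear_combination -h4)) (cancel (by linear_combination -h5))
  refine hv (funext fun i ↦ ?_)
  fin_cases i <;> assumption

theorem hasCommonZero_of_gramMatrix_det_eq_zero (h2 : (2 : K) ≠ 0) {u : Fin 3 → Fin 6 → K}
    (hu : (gramMatrix (u 0)).det = 0) (h : (pfaffianMatrix (pluckerBracket u)).det = 0) :
    HasCommonZero u := by
  obtain ⟨g, hg, e, he⟩ := exists_normal_form h2 hu
  refine .of_quadSubst hg ?_
  have h' := det_pfaffianMatrix_quadSubst g hg u h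
  by_cases he0 : e = 0
  · subst he0
    refine hasCommonZero_of_zero h2 ?_
    rcases he with he | he <;> simp [he]
  · rcases he with he | he
    · exact hasCommonZero_of_xy he0 he h'
    · exact hasCommonZero_of_x_sq he0 he h'

theorem hasCommonZero_of_det_pfaffianMatrix_eq_zero (h2 : (2 : K) ≠ 0)
    {u : Matrix (Fin 3) (Fin 6) K} (h : (pfaffianMatrix (pluckerBracket u)).det = 0) :
    HasCommonZero u := by
  have hmul (A : Matrix (Fin 3) (Fin 3) K) :
      (pfaffianMatrix (pluckerBracket (A * u))).det = 0 := by
    rw [pluckerBracket_mul, pfaffianMatrix_smul, Matrix.det_smul, h, mul_zero]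
  rcases exists_gramMatrix_det_eq_zero (u 0) (u 1) with hu | ⟨t, ht⟩
  · refine .of_mul (h := !![0, 1, 0; 1, 0, 0; 0, 0, 1]) (by simp [Matrix.det_fin_three]) <|
      hasCommonZero_of_gramMatrix_det_eq_zero h2 ?_ (hmul _)
    convert hu using 3
    ext i
    simp [Matrix.mul_apply, Fin.sum_univ_three]
  · refine .of_mul (h := !![1, t, 0; 0, 1, 0; 0, 0, 1]) (by simp [Matrix.det_fin_three]) <|
      hasCommonZero_of_gramMatrix_det_eq_zero h2 ?_ (hmul _)
    convert ht using 3
    ext i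
    simp [Matrix.mul_apply, Fin.sum_univ_three]

end AlgClosed

end Field

/-- **Pfaffian Bézout formula for the resultant of three ternary quadrics (squared form).**
The determinant of the displayed 8×8 alternating matrix of linear forms in the Plücker
coordinates vanishes iff the three quadrics have a common nontrivial zero. -/
theorem det_pfaffian_matrix_eq_zero_iff_common_zero
    {K : Type*} [Field K] [IsAlgClosed K] (hchar : ringChar K ≠ 2)
    (u : Fin 3 → Fin 6 → K) :
    Matrix.det (show Matrix (Fin 8) (Fin 8) K from
      let P := pluckerBracket u
      !![0,        P 2 4 5,            P 3 4 5,  P 1 3 5,            P 0 4 5,            P 0 3 5,            P 1 4 5,            P 2 3 5;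
        -P 2 4 5,  0,                 -P 2 3 5,  P 0 3 5,            P 0 2 5,            P 0 1 5,            P 1 2 5,           -P 1 2 5 + P 0 4 5;
        -P 3 4 5,  P 2 3 5,            0,        P 1 3 4,            P 0 3 5,            P 0 3 4,            P 1 3 5,            P 2 3 4;
        -P 1 3 5, -P 0 3 5,           -P 1 3 4,  0,                  P 0 2 3,            P 0 1 3,            P 1 2 3 - P 0 3 4, -P 1 2 3;
        -P 0 4 5, -P 0 2 5,           -P 0 3 5, -P 0 2 3,            0,                  P 0 1 2,           -P 0 1 5,           -P 0 2 4 + P 0 1 5;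
        -P 0 3 5, -P 0 1 5,           -P 0 3 4, -P 0 1 3,           -P 0 1 2,            0,                  P 0 2 3 - P 0 1 4, -P 0 2 3;
        -P 1 4 5, -P 1 2 5,           -P 1 3 5, -P 1 2 3 + P 0 3 4,  P 0 1 5,           -P 0 2 3 + P 0 1 4,  0,                 -P 1 2 4 + P 0 3 5;
        -P 2 3 5,  P 1 2 5 - P 0 4 5, -P 2 3 4,  P 1 2 3,            P 0 2 4 - P 0 1 5,  P 0 2 3,            P 1 2 4 - P 0 3 5,  0]) = 0
    ↔ ∃ x y z : K, (x, y, z) ≠ (0, 0, 0) ∧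
        ternaryQuad (u 0) x y z = 0 ∧ ternaryQuad (u 1) x y z = 0 ∧
        ternaryQuad (u 2) x y z = 0 := by
  have h2 : (2 : K) ≠ 0 := Ring.two_ne_zero hchar
  have hzero : HasCommonZero u ↔ ∃ x y z : K, (x, y, z) ≠ (0, 0, 0) ∧
      ternaryQuad (u 0) x y z = 0 ∧ ternaryQuad (u 1) x y z = 0 ∧
      ternaryQuad (u 2) x y z = 0 := by
    simp [HasCommonZero, Fin.exists_fin_succ_pi, Fin.forall_fin_succ, funext_iff]
  rw [← hzero]
  exact ⟨hasCommonZero_of_det_pfaffianMatrix_eq_zero h2, (·.det_pfaffianMatrix_eq_zero)⟩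
end

section
/- Let K be an algebraically closed field. Let q₁, q₂, q₃ be three ternary quadratic forms over K with coefficient vectors (a_0,…,a_5), (b_0,…,b_5), (c_0,…,c_5) respectively (indexed by the monomials x², xy, xz, y², yz, z²), and for 0 ≤ i < j < k ≤ 5 let [i,j,k] = det of the 3×3 matrix with rows (a_i,b_i,c_i), (a_j,b_j,c_j), (a_k,b_k,c_k). Let N be the 6×6 matrix whose rows are: Row 1: (a_0, b_0, c_0, [0,1,5], 0, [0,1,2]); Row 2: (a_1, b_1, c_1, [0,3,5], [0,3,4], [0,1,4]−[0,2,3]); Row 3: (a_2, b_2, c_2, [0,4,5]−[1,2,5], [0,3,5], [0,1,5]); Row 4: (a_3, b_3, c_3, 0, [1,3,4], [0,3,4]); Row 5: (a_4, b_4, c_4, [2,3,5], [2,3,4]+[1,3,5], [0,3,5]); Row 6: (a_5, b_5, c_5, [2,4,5], [2,3,5], 0). Then det N = 0 if and only if there exists (x,y,z) ∈ K³ with (x,y,z) ≠ (0,0,0) and q₁(x,y,z) = q₂(x,y,z) = q₃(x,y,z) = 0. (The determinant of N is the resultant of the three quadratic forms.) -/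
/-- The Plücker coordinate `[i,j,k]` of the net of quadrics with coefficient vectors
`a`, `b`, `c`: the determinant of the 3×3 matrix with rows `(a_i,b_i,c_i)`,
`(a_j,b_j,c_j)`, `(a_k,b_k,c_k)`. -/
def netPlucker {K : Type*} [CommRing K] (a b c : Fin 6 → K) (i j k : Fin 6) : K :=
  Matrix.det !![a i, b i, c i; a j, b j, c j; a k, b k, c k]

open MvPolynomial in
/-- Exactness of the Koszul complex of `X 0, X 1, X 2` in degree one. -/
lemma MvPolynomial.exists_eq_cross_of_sum_mul_X_eq_zero {K : Type*} [Field K]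
    {r : Fin 3 → MvPolynomial (Fin 3) K} (hr : r 0 * X 0 + r 1 * X 1 + r 2 * X 2 = 0) :
    ∃ w : Fin 3 → MvPolynomial (Fin 3) K,
      r 0 = X 1 * w 2 - X 2 * w 1 ∧ r 1 = X 2 * w 0 - X 0 * w 2 ∧
        r 2 = X 0 * w 1 - X 1 * w 0 := by
  have hmem : r 1 ∈ Ideal.span (X '' ({0, 2} : Set (Fin 3))) := by
    have hX : r 1 * X 1 ∈ Ideal.span ((X : Fin 3 → MvPolynomial (Fin 3) K) '' {0, 2}) := by
      rw [Set.image_pair, Ideal.mem_span_pair]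
      exact ⟨-r 0, -r 2, by linear_combination -hr⟩
    rw [mem_ideal_span_X_image] at hX ⊢
    intro m hm
    obtain ⟨i, hi, hne⟩ := hX (m + Finsupp.single 1 1) (by
      rw [mem_support_iff] at hm ⊢
      rwa [coeff_mul_X])
    refine ⟨i, hi, ?_⟩
    rcases hi with rfl | rfl <;> simpa using hne
  rw [Set.image_pair, Ideal.mem_span_pair] at hmem
  obtain ⟨s, t, hst⟩ := hmem
  have hdvd : (X 2 : MvPolynomial (Fin 3) K) ∣ X 0 * (r 0 + X 1 * s) :=
    ⟨-(r 2 + X 1 * t), by linear_combination hr + X 1 * hst⟩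
  obtain ⟨u, hu⟩ := ((X_prime (i := (2 : Fin 3))).dvd_or_dvd hdvd).resolve_left (by simp [X_dvd_X])
  refine ⟨![t, -u, -s], ?_, ?_, ?_⟩
  · simp
    linear_combination hu
  · simp
    linear_combination -hst
  · simp
    refine mul_left_cancel₀ (X_ne_zero (2 : Fin 3)) ?_
    linear_combination hr + X 1 * hst - X 0 * hu

open MvPolynomial in
/-- The determinant of a transition matrix from `X` to `f` is well defined modulo `f`. -/
lemma MvPolynomial.det_sub_det_mem_span_of_mulVec_X_eq {K : Type*} [Field K]
    {P Q : Matrix (Fin 3) (Fin 3) (MvPolynomial (Fin 3) K)} (h : P.mulVec X = Q.mulVec X) :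
    P.det - Q.det ∈ Ideal.span (Set.range (Q.mulVec X)) := by
  have key (i : Fin 3) := exists_eq_cross_of_sum_mul_X_eq_zero (r := fun j => P i j - Q i j) (by
    have := congrFun h i
    simp only [Matrix.mulVec, dotProduct, Fin.sum_univ_three] at this
    linear_combination this)
  choose w h0 h1 h2 using key
  simp only [sub_eq_iff_eq_add] at h0 h1 h2
  rw [Ideal.mem_span_range_iff_exists_fun]
  refine ⟨![w 2 ⬝ᵥ Q 1 - w 1 ⬝ᵥ P 2, w 0 ⬝ᵥ P 2 - w 2 ⬝ᵥ Q 0, w 1 ⬝ᵥ Q 0 - w 0 ⬝ᵥ P 1], ?_⟩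
  simp [Matrix.mulVec, dotProduct, Fin.sum_univ_three, Matrix.det_fin_three, h0, h1, h2]
  ring

/-- Cramer's rule, as an ideal membership. -/
lemma Matrix.mul_det_mem_span_range_mulVec {n R : Type*} [Fintype n] [DecidableEq n] [CommRing R]
    (M : Matrix n n R) (v : n → R) (j : n) :
    v j * M.det ∈ Ideal.span (Set.range (M.mulVec v)) := by
  rw [Ideal.mem_span_range_iff_exists_fun]
  refine ⟨M.adjugate j, ?_⟩
  have h : M.adjugate.mulVec (M.mulVec v) j = v j * M.det := by
    rw [Matrix.mulVec_mulVec, Matrix.adjugate_mul, Matrix.smul_mulVec, Matrix.one_mulVec]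
    simp [mul_comm]
  rw [← h, Matrix.mulVec, dotProduct]

open MvPolynomial in
lemma MvPolynomial.prod_X_pow_notMem_span_X_pow_succ {K : Type*} [Field K] (n : ℕ) :
    ∏ i, X i ^ n ∉
      Ideal.span (Set.range fun i : Fin 3 => (X i ^ (n + 1) : MvPolynomial (Fin 3) K)) := by
  have hp : ∏ i : Fin 3, (X i ^ n : MvPolynomial (Fin 3) K) =
      monomial (∑ i, Finsupp.single i n) 1 := by
    simp [X_pow_eq_monomial, monomial_sum_one]
  have hs : (Set.range fun i : Fin 3 => (X i ^ (n + 1) : MvPolynomial (Fin 3) K)) =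
      (fun s => monomial s 1) '' Set.range fun i : Fin 3 => Finsupp.single i (n + 1) := by
    rw [← Set.range_comp]
    simp only [X_pow_eq_monomial, Function.comp_def]
  rw [hp, hs, mem_ideal_span_monomial_image]
  intro h
  obtain ⟨_, ⟨i, rfl⟩, hi⟩ := h (∑ i, Finsupp.single i n) (by simp [mem_support_iff])
  have := hi i
  simp [Finsupp.finsetSum_apply, Finsupp.single_apply] at this

open MvPolynomial in
/-- Wiebe's theorem: the determinant of a transition matrix from `X` to a system of parameters
`f` does not lie in the ideal generated by `f`. -/
lemma MvPolynomial.det_notMem_span_range_mulVec_X {K : Type*} [Field K]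
    (M : Matrix (Fin 3) (Fin 3) (MvPolynomial (Fin 3) K))
    (hM : ∀ i, X i ∈ (Ideal.span (Set.range (M.mulVec X))).radical) :
    M.det ∉ Ideal.span (Set.range (M.mulVec X)) := by
  intro hdet
  choose e he using hM
  let n := ∑ i, e i
  have hpow (i : Fin 3) : X i ^ (n + 1) ∈ Ideal.span (Set.range (M.mulVec X)) :=
    Ideal.pow_mem_of_pow_mem _ (he i)
      ((Finset.single_le_sum (fun _ _ => Nat.zero_le _) (Finset.mem_univ i)).trans n.le_succ)
  simp only [Ideal.mem_span_range_iff_exists_fun] at hpow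
  choose B hB using hpow
  let D : Matrix (Fin 3) (Fin 3) (MvPolynomial (Fin 3) K) := Matrix.diagonal fun i => X i ^ n
  have hD : D.mulVec X = fun i => X i ^ (n + 1) := by
    ext1 i
    rw [Matrix.mulVec_diagonal, pow_succ]
  have hBM : (Matrix.of B).mulVec (M.mulVec X) = D.mulVec X := by
    rw [hD]
    ext1 i
    exact hB i
  have hBdet : (Matrix.of B).det * M.det ∈ Ideal.span (Set.range (D.mulVec X)) := by
    rw [Ideal.mem_span_range_iff_exists_fun] at hdet
    obtain ⟨c, hc⟩ := hdet
    rw [← hc, Finset.mul_sum, ← hBM]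
    refine Ideal.sum_mem _ fun j _ => ?_
    rw [mul_left_comm, mul_comm (Matrix.of B).det]
    exact Ideal.mul_mem_left _ _ (Matrix.mul_det_mem_span_range_mulVec _ _ j)
  have hsub := det_sub_det_mem_span_of_mulVec_X_eq (P := Matrix.of B * M) (Q := D)
    (by rw [← Matrix.mulVec_mulVec, hBM])
  rw [Matrix.det_mul] at hsub
  have hmem := Ideal.sub_mem _ hBdet hsub
  rw [sub_sub_cancel, hD, Matrix.det_diagonal] at hmem
  exact prod_X_pow_notMem_span_X_pow_succ n hmem

section TernaryNet

variable {R : Type*} [CommRing R]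

/-- The coefficients of `x²`, `y`, `z` in ternary quadratic forms. -/
def quadMatrixX (F : Fin 3 → Fin 6 → R) (x y z : R) : Matrix (Fin 3) (Fin 3) R :=
  Matrix.of fun i => ![F i 0, F i 1 * x + F i 3 * y, F i 2 * x + F i 4 * y + F i 5 * z]

/-- The coefficients of `x`, `y²`, `z` in ternary quadratic forms. -/
def quadMatrixY (F : Fin 3 → Fin 6 → R) (x y z : R) : Matrix (Fin 3) (Fin 3) R :=
  Matrix.of fun i => ![F i 0 * x + F i 1 * y + F i 2 * z, F i 3, F i 4 * y + F i 5 * z]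

/-- The coefficients of `x`, `y`, `z²` in ternary quadratic forms. -/
def quadMatrixZ (F : Fin 3 → Fin 6 → R) (x y z : R) : Matrix (Fin 3) (Fin 3) R :=
  Matrix.of fun i => ![F i 0 * x + F i 2 * z, F i 1 * x + F i 3 * y + F i 4 * z, F i 5]

lemma quadMatrixX_mulVec (F : Fin 3 → Fin 6 → R) (x y z : R) :
    (quadMatrixX F x y z).mulVec ![x ^ 2, y, z] = fun i => ternaryQuad (F i) x y z := by
  ext1 i
  simp [quadMatrixX, ternaryQuad, Matrix.mulVec, dotProduct, Fin.sum_univ_three]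
  ring

lemma quadMatrixY_mulVec (F : Fin 3 → Fin 6 → R) (x y z : R) :
    (quadMatrixY F x y z).mulVec ![x, y ^ 2, z] = fun i => ternaryQuad (F i) x y z := by
  ext1 i
  simp [quadMatrixY, ternaryQuad, Matrix.mulVec, dotProduct, Fin.sum_univ_three]
  ring

lemma quadMatrixZ_mulVec (F : Fin 3 → Fin 6 → R) (x y z : R) :
    (quadMatrixZ F x y z).mulVec ![x, y, z ^ 2] = fun i => ternaryQuad (F i) x y z := by
  ext1 i
  simp [quadMatrixZ, ternaryQuad, Matrix.mulVec, dotProduct, Fin.sum_univ_three]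
  ring

/-- The matrix whose determinant is the resultant of a net of conics. -/
def netMatrix (a b c : Fin 6 → R) : Matrix (Fin 6) (Fin 6) R :=
  let P := netPlucker a b c
  !![a 0, b 0, c 0, P 0 1 5,            0,                  P 0 1 2;
     a 1, b 1, c 1, P 0 3 5,            P 0 3 4,            P 0 1 4 - P 0 2 3;
     a 2, b 2, c 2, P 0 4 5 - P 1 2 5,  P 0 3 5,            P 0 1 5;
     a 3, b 3, c 3, 0,                  P 1 3 4,            P 0 3 4;
     a 4, b 4, c 4, P 2 3 5,            P 2 3 4 + P 1 3 5,  P 0 3 5;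
     a 5, b 5, c 5, P 2 4 5,            P 2 3 5,            0]

/-- The columns of `netMatrix` are the coefficient vectors of the three forms of the net and of
three further quadratic forms given as determinants. -/
lemma vecMul_netMatrix (a b c : Fin 6 → R) (x y z : R) :
    Matrix.vecMul ![x ^ 2, x * y, x * z, y ^ 2, y * z, z ^ 2] (netMatrix a b c) =
      ![ternaryQuad a x y z, ternaryQuad b x y z, ternaryQuad c x y z,
        (quadMatrixZ ![a, b, c] x y z).det, (quadMatrixY ![a, b, c] x y z).det,
        (quadMatrixX ![a, b, c] x y z).det] := by
  ext1 i
  fin_cases i <;>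
    simp [Matrix.vecMul, dotProduct, Fin.sum_univ_succ, netMatrix, netPlucker, ternaryQuad,
      quadMatrixX, quadMatrixY, quadMatrixZ, Matrix.det_fin_three] <;> ring

lemma map_netPlucker {S : Type*} [CommRing S] (f : R →+* S) (a b c : Fin 6 → R) (i j k : Fin 6) :
    f (netPlucker a b c i j k) = netPlucker (f ∘ a) (f ∘ b) (f ∘ c) i j k := by
  simp [netPlucker, Matrix.det_fin_three]

lemma netMatrix_map {S : Type*} [CommRing S] (f : R →+* S) (a b c : Fin 6 → R) :
    (netMatrix a b c).map f = netMatrix (f ∘ a) (f ∘ b) (f ∘ c) := by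
  ext i j
  fin_cases i <;> fin_cases j <;> simp [netMatrix, map_netPlucker]

end TernaryNet

lemma det_netMatrix_eq_zero_of_common_zero {K : Type*} [Field K] {a b c : Fin 6 → K} {x y z : K}
    (hne : (x, y, z) ≠ (0, 0, 0)) (ha : ternaryQuad a x y z = 0) (hb : ternaryQuad b x y z = 0)
    (hc : ternaryQuad c x y z = 0) : (netMatrix a b c).det = 0 := by
  have hq : (fun i => ternaryQuad ((![a, b, c] : Fin 3 → Fin 6 → K) i) x y z) = 0 := by
    ext1 i
    fin_cases i <;> simpa
  have hdet (M : Matrix (Fin 3) (Fin 3) K) (v : Fin 3 → K) (h : M.mulVec v = 0) (hv : v ≠ 0) :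
      M.det = 0 := Matrix.exists_mulVec_eq_zero_iff.mp ⟨v, hv, h⟩
  rw [← Matrix.exists_vecMul_eq_zero_iff]
  refine ⟨![x ^ 2, x * y, x * z, y ^ 2, y * z, z ^ 2], ?_, ?_⟩
  · intro h
    have hx := congrFun h 0
    have hy := congrFun h 3
    have hz := congrFun h 5
    simp_all
  · rw [vecMul_netMatrix, ha, hb, hc,
      hdet _ _ ((quadMatrixX_mulVec ![a, b, c] x y z).trans hq) (by simpa using hne),
      hdet _ _ ((quadMatrixY_mulVec ![a, b, c] x y z).trans hq) (by simpa using hne),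
      hdet _ _ ((quadMatrixZ_mulVec ![a, b, c] x y z).trans hq) (by simpa using hne)]
    simp

open MvPolynomial in
/-- A projective Nullstellensatz for three ternary quadratic forms. -/
lemma X_mem_radical_of_no_common_zero {K : Type*} [Field K] [IsAlgClosed K]
    (F : Fin 3 → Fin 6 → K)
    (h : ∀ x y z : K, (∀ i, ternaryQuad (F i) x y z = 0) → (x, y, z) = (0, 0, 0)) (j : Fin 3) :
    (X j : MvPolynomial (Fin 3) K) ∈ (Ideal.span (Set.range fun i =>
      ternaryQuad (C ∘ F i) (X 0) (X 1) (X 2 : MvPolynomial (Fin 3) K))).radical := by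
  rw [← vanishingIdeal_zeroLocus_eq_radical (K := K), mem_vanishingIdeal_iff]
  intro p hp
  have hzero := h (p 0) (p 1) (p 2) fun i => by
    simpa [ternaryQuad] using hp _ (Ideal.subset_span ⟨i, rfl⟩)
  simp only [Prod.mk.injEq] at hzero
  fin_cases j <;> simp [hzero]

open MvPolynomial in
/-- Wiebe's theorem for a transition matrix from multiples of the variables. -/
lemma MvPolynomial.prod_mul_det_notMem_span {K : Type*} [Field K]
    {M : Matrix (Fin 3) (Fin 3) (MvPolynomial (Fin 3) K)}
    {d v f : Fin 3 → MvPolynomial (Fin 3) K} (hv : d * X = v) (hf : M.mulVec v = f)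
    (hrad : ∀ i, X i ∈ (Ideal.span (Set.range f)).radical) :
    (∏ i, d i) * M.det ∉ Ideal.span (Set.range f) := by
  have hMd : (M * Matrix.diagonal d).mulVec X = f := by
    rw [← Matrix.mulVec_mulVec, ← hf, ← hv]
    congr 1
    ext1 i
    rw [Matrix.mulVec_diagonal, Pi.mul_apply]
  have := det_notMem_span_range_mulVec_X (M * Matrix.diagonal d) (by rwa [hMd])
  rwa [hMd, Matrix.det_mul, Matrix.det_diagonal, mul_comm] at this

open MvPolynomial in
lemma exists_common_zero_of_det_netMatrix_eq_zero {K : Type*} [Field K] [IsAlgClosed K]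
    {a b c : Fin 6 → K} (hdet : (netMatrix a b c).det = 0) :
    ∃ x y z : K, (x, y, z) ≠ (0, 0, 0) ∧
      ternaryQuad a x y z = 0 ∧ ternaryQuad b x y z = 0 ∧ ternaryQuad c x y z = 0 := by
  by_contra! hno
  have hrad := X_mem_radical_of_no_common_zero ![a, b, c] fun x y z hq => by
    by_contra hne
    exact hno x y z hne (hq 0) (hq 1) (hq 2)
  obtain ⟨w, hw0, hw⟩ := Matrix.exists_mulVec_eq_zero_iff.mpr hdet
  set f : Fin 3 → MvPolynomial (Fin 3) K := fun i =>
    ternaryQuad (C ∘ (![a, b, c] : Fin 3 → Fin 6 → K) i) (X 0) (X 1) (X 2) with hf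
  set F : Fin 3 → Fin 6 → MvPolynomial (Fin 3) K := ![C ∘ a, C ∘ b, C ∘ c]
  have hfF : (fun i => ternaryQuad (F i) (X 0) (X 1) (X 2)) = f := by
    ext1 i
    fin_cases i <;> rfl
  set I := Ideal.span (Set.range f)
  have hfI (i : Fin 3) : f i ∈ I := Ideal.subset_span ⟨i, rfl⟩
  -- Cramer's rule and Wiebe's theorem for the three determinantal quadrics.
  have hX := (quadMatrixX_mulVec F (X 0) (X 1) (X 2)).trans hfF
  have hY := (quadMatrixY_mulVec F (X 0) (X 1) (X 2)).trans hfF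
  have hZ := (quadMatrixZ_mulVec F (X 0) (X 1) (X 2)).trans hfF
  have memX := Matrix.mul_det_mem_span_range_mulVec
    (quadMatrixX F (X 0) (X 1) (X 2)) ![X 0 ^ 2, X 1, X 2]
  have memY := Matrix.mul_det_mem_span_range_mulVec
    (quadMatrixY F (X 0) (X 1) (X 2)) ![X 0, X 1 ^ 2, X 2]
  have memZ := Matrix.mul_det_mem_span_range_mulVec
    (quadMatrixZ F (X 0) (X 1) (X 2)) ![X 0, X 1, X 2 ^ 2]
  rw [hX] at memX
  rw [hY] at memY
  rw [hZ] at memZ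
  have notMemX := prod_mul_det_notMem_span (d := ![X 0, 1, 1])
    (by ext1 i; fin_cases i <;> simp [pow_two]) hX hrad
  have notMemY := prod_mul_det_notMem_span (d := ![1, X 1, 1])
    (by ext1 i; fin_cases i <;> simp [pow_two]) hY hrad
  have notMemZ := prod_mul_det_notMem_span (d := ![1, 1, X 2])
    (by ext1 i; fin_cases i <;> simp [pow_two]) hZ hrad
  simp only [Fin.prod_univ_three, Matrix.cons_val, one_mul, mul_one] at notMemX notMemY notMemZ
  set dX := (quadMatrixX F (X 0) (X 1) (X 2)).det
  set dY := (quadMatrixY F (X 0) (X 1) (X 2)).det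
  set dZ := (quadMatrixZ F (X 0) (X 1) (X 2)).det
  have hrel : C (w 0) * f 0 + C (w 1) * f 1 + C (w 2) * f 2 +
      C (w 3) * dZ + C (w 4) * dY + C (w 5) * dX = 0 := by
    have hCw : ((netMatrix a b c).map C).mulVec (C ∘ w : Fin 6 → MvPolynomial (Fin 3) K) = 0 := by
      ext1 i
      rw [← RingHom.map_mulVec, hw, Pi.zero_apply, C_0, Pi.zero_apply]
    have h : Matrix.vecMul ![X 0 ^ 2, X 0 * X 1, X 0 * X 2, X 1 ^ 2, X 1 * X 2, X 2 ^ 2]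
        ((netMatrix a b c).map C) ⬝ᵥ (C ∘ w : Fin 6 → MvPolynomial (Fin 3) K) = 0 := by
      rw [← Matrix.dotProduct_mulVec, hCw, dotProduct_zero]
    rw [netMatrix_map, vecMul_netMatrix] at h
    simp only [dotProduct, Fin.sum_univ_six, Matrix.cons_val, Function.comp_apply] at h
    simp only [hf, Matrix.cons_val]
    linear_combination h
  have hsum : C (w 0) * f 0 + C (w 1) * f 1 + C (w 2) * f 2 ∈ I :=
    add_mem (add_mem (I.mul_mem_left _ (hfI 0)) (I.mul_mem_left _ (hfI 1)))
      (I.mul_mem_left _ (hfI 2))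
  have cancel (r : K) (p : MvPolynomial (Fin 3) K) (hp : p ∉ I) (hr : C r * p ∈ I) : r = 0 := by
    by_contra hne
    refine hp ?_
    have := I.mul_mem_left (C r⁻¹) hr
    rwa [← mul_assoc, ← C_mul, inv_mul_cancel₀ hne, C_1, one_mul] at this
  have w3 : w 3 = 0 := cancel _ _ notMemZ (by
    have e : C (w 3) * (X 2 * dZ) = -(X 2 * (C (w 0) * f 0 + C (w 1) * f 1 + C (w 2) * f 2) +
        C (w 4) * (X 2 * dY) + C (w 5) * (X 2 * dX)) := by
      linear_combination X 2 * hrel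
    rw [e]
    exact neg_mem (add_mem (add_mem (I.mul_mem_left _ hsum) (I.mul_mem_left _ (memY 2)))
      (I.mul_mem_left _ (memX 2))))
  have w4 : w 4 = 0 := cancel _ _ notMemY (by
    have e : C (w 4) * (X 1 * dY) = -(X 1 * (C (w 0) * f 0 + C (w 1) * f 1 + C (w 2) * f 2) +
        C (w 3) * (X 1 * dZ) + C (w 5) * (X 1 * dX)) := by
      linear_combination X 1 * hrel
    rw [e]
    exact neg_mem (add_mem (add_mem (I.mul_mem_left _ hsum) (I.mul_mem_left _ (memZ 1)))
      (I.mul_mem_left _ (memX 1))))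
  have w5 : w 5 = 0 := cancel _ _ notMemX (by
    have e : C (w 5) * (X 0 * dX) = -(X 0 * (C (w 0) * f 0 + C (w 1) * f 1 + C (w 2) * f 2) +
        C (w 3) * (X 0 * dZ) + C (w 4) * (X 0 * dY)) := by
      linear_combination X 0 * hrel
    rw [e]
    exact neg_mem (add_mem (add_mem (I.mul_mem_left _ hsum) (I.mul_mem_left _ (memZ 0)))
      (I.mul_mem_left _ (memY 0))))
  -- The forms `a`, `b`, `c` are then linearly dependent.
  have hdep (j : Fin 6) : w 0 * a j + w 1 * b j + w 2 * c j = 0 := by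
    have := congrFun hw j
    fin_cases j <;>
      simp [Matrix.mulVec, dotProduct, Fin.sum_univ_succ, netMatrix, w3, w4, w5] at this ⊢ <;>
      linear_combination this
  refine notMemX ?_
  have hdX : dX = 0 := by
    rw [← Matrix.exists_vecMul_eq_zero_iff]
    refine ⟨![C (w 0), C (w 1), C (w 2)], ?_, ?_⟩
    · intro h
      refine hw0 (funext fun j => ?_)
      have h0 := congrFun h 0
      have h1 := congrFun h 1
      have h2 := congrFun h 2
      simp at h0 h1 h2
      fin_cases j <;> simp [*]
    · have hC (j : Fin 6) : C (w 0) * C (a j) + C (w 1) * C (b j) + C (w 2) * C (c j) =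
          (0 : MvPolynomial (Fin 3) K) := by
        simp only [← C_mul, ← C_add, hdep, C_0]
      ext1 i
      fin_cases i <;> simp [Matrix.vecMul, dotProduct, Fin.sum_univ_three, quadMatrixX, F]
      · linear_combination hC 0
      · linear_combination X 0 * hC 1 + X 1 * hC 3
      · linear_combination X 0 * hC 2 + X 1 * hC 4 + X 2 * hC 5
  rw [hdX, mul_zero]
  exact I.zero_mem

/-- **Determinantal formula for the resultant of three ternary quadrics**
(the Chow form of the 2-uple embedding of `P²`, in mixed Stiefel/Plücker coordinates):
the determinant of the displayed 6×6 matrix vanishes iff the three quadrics have a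
common nontrivial zero. -/
theorem det_sixBySix_eq_zero_iff_common_zero
    {K : Type*} [Field K] [IsAlgClosed K] (a b c : Fin 6 → K) :
    Matrix.det (show Matrix (Fin 6) (Fin 6) K from
      let P := netPlucker a b c
      !![a 0, b 0, c 0, P 0 1 5,            0,                  P 0 1 2;
         a 1, b 1, c 1, P 0 3 5,            P 0 3 4,            P 0 1 4 - P 0 2 3;
         a 2, b 2, c 2, P 0 4 5 - P 1 2 5,  P 0 3 5,            P 0 1 5;
         a 3, b 3, c 3, 0,                  P 1 3 4,            P 0 3 4;
         a 4, b 4, c 4, P 2 3 5,            P 2 3 4 + P 1 3 5,  P 0 3 5;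
         a 5, b 5, c 5, P 2 4 5,            P 2 3 5,            0]) = 0
    ↔ ∃ x y z : K, (x, y, z) ≠ (0, 0, 0) ∧
        ternaryQuad a x y z = 0 ∧ ternaryQuad b x y z = 0 ∧ ternaryQuad c x y z = 0 := by
  exact ⟨exists_common_zero_of_det_netMatrix_eq_zero, fun ⟨_, _, _, hne, ha, hb, hc⟩ =>
    det_netMatrix_eq_zero_of_common_zero hne ha hb hc⟩
end

section
/- Assume the hyperelliptic setup of the context: K algebraically closed with char K ≠ 2, f ∈ K[t] squarefree of degree 2g+2 with factorization f = f⁽¹⁾·f⁽²⁾ into factors of degree g+1, an integer k ≥ g+1, polynomials a, c of degree ≤ k and b, d of degree ≤ k−g−1 with (a,b) and (c,d) linearly independent over K. Let M be the 4k×4k block matrix [[syl(k,a), syl(k,b·f⁽²⁾), syl(k,c), syl(k,d·f⁽²⁾)], [syl(k,b·f⁽¹⁾), syl(k,a), syl(k,d·f⁽¹⁾), syl(k,c)]], where each block syl(k,r) is the 2k×k matrix defined in the context. Then det M = 0 if and only if the functions a+b√f and c+d√f have a common zero on the hyperelliptic curve s² = f(t), i.e. either there exist t₀, s₀ ∈ K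 with s₀² = f(t₀), a(t₀)+b(t₀)s₀ = 0 and c(t₀)+d(t₀)s₀ = 0, or there exists w ∈ K with w² = f_{2g+2}, a_k + w·b_{k−g−1} = 0 and c_k + w·d_{k−g−1} = 0. -/
open Polynomial

/-- The `(u,l)` entry (0-based) of the `2k × k` Sylvester block `syl(k,r)` of a
polynomial `r` of degree ≤ `k`: the entry `r_{u−l}` in row `u`, column `l`, with
`r_m := 0` for `m < 0` or `m > k`. -/
def sylBlockEntry {K : Type*} [CommRing K] (k : ℕ) (r : Polynomial K) (u l : ℕ) : K :=
  if l ≤ u ∧ u - l ≤ k then r.coeff (u - l) else 0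

/-- The `4k × 4k` matrix built from two block rows of four `2k × k`
Sylvester blocks: `[[syl(k,r11), syl(k,r12), syl(k,r13), syl(k,r14)],
[syl(k,r21), syl(k,r22), syl(k,r23), syl(k,r24)]]`. -/
def sylBlockMatrix {K : Type*} [CommRing K] (k : ℕ)
    (r11 r12 r13 r14 r21 r22 r23 r24 : Polynomial K) :
    Matrix (Fin (4 * k)) (Fin (4 * k)) K :=
  Matrix.of fun u v =>
    if u.val < 2 * k then
      if v.val < k then sylBlockEntry k r11 u.val (v.val % k)
      else if v.val < 2 * k then sylBlockEntry k r12 u.val (v.val % k)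
      else if v.val < 3 * k then sylBlockEntry k r13 u.val (v.val % k)
      else sylBlockEntry k r14 u.val (v.val % k)
    else
      if v.val < k then sylBlockEntry k r21 (u.val - 2 * k) (v.val % k)
      else if v.val < 2 * k then sylBlockEntry k r22 (u.val - 2 * k) (v.val % k)
      else if v.val < 3 * k then sylBlockEntry k r23 (u.val - 2 * k) (v.val % k)
      else sylBlockEntry k r24 (u.val - 2 * k) (v.val % k)

section SylvesterMatrix

variable {K : Type*} [Field K]

theorem sylBlockEntry_eq_coeff_mul_X_pow {k : ℕ} {r : K[X]} (hr : r.natDegree ≤ k) (u l : ℕ) :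
    sylBlockEntry k r u l = (r * X ^ l).coeff u := by
  rw [sylBlockEntry, coeff_mul_X_pow']
  by_cases hl : l ≤ u
  · by_cases hu : u - l ≤ k
    · simp [hl, hu]
    · simp [hl, hu, coeff_eq_zero_of_natDegree_lt (lt_of_le_of_lt hr (not_le.mp hu))]
  · simp [hl]

/-- The polynomial of degree less than `k` whose coefficients are the entries of `x` from
position `n` on. -/
noncomputable def polyOfSlice (k : ℕ) (x : ℕ → K) (n : ℕ) : K[X] :=
  ∑ j ∈ Finset.range k, C (x (n + j)) * X ^ j

theorem coeff_polyOfSlice (k : ℕ) (x : ℕ → K) (n j : ℕ) :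
    (polyOfSlice k x n).coeff j = if j < k then x (n + j) else 0 := by
  simp [polyOfSlice, finsetSum_coeff, coeff_C_mul, coeff_X_pow]

theorem sum_sylBlockEntry_mul {k : ℕ} {r : K[X]} (hr : r.natDegree ≤ k) (x : ℕ → K) (n u : ℕ) :
    ∑ j ∈ Finset.range k, sylBlockEntry k r u j * x (n + j) =
      (r * polyOfSlice k x n).coeff u := by
  rw [polyOfSlice, Finset.mul_sum, finsetSum_coeff]
  refine Finset.sum_congr rfl fun j _ => ?_
  rw [sylBlockEntry_eq_coeff_mul_X_pow hr, mul_left_comm, coeff_C_mul, mul_comm]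

/-- The sum over the columns of a matrix with four blocks of `k` columns. -/
theorem sum_fin_four_mul (k : ℕ) (e : ℕ → K) :
    ∑ v : Fin (4 * k), e v =
      ∑ j ∈ Finset.range k, e j + ∑ j ∈ Finset.range k, e (k + j) +
        ∑ j ∈ Finset.range k, e (2 * k + j) + ∑ j ∈ Finset.range k, e (3 * k + j) := by
  rw [Fin.sum_univ_eq_sum_range e, show 4 * k = k + k + k + k by ring,
    Finset.sum_range_add, Finset.sum_range_add, Finset.sum_range_add]
  simp only [show k + k = 2 * k by ring, show 2 * k + k = 3 * k by ring]

theorem sum_four_blocks (k : ℕ) (e₁ e₂ e₃ e₄ : ℕ → K) (x : ℕ → K) :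
    ∑ v : Fin (4 * k), (if v.val < k then e₁ (v.val % k)
      else if v.val < 2 * k then e₂ (v.val % k)
      else if v.val < 3 * k then e₃ (v.val % k)
      else e₄ (v.val % k)) * x v =
      ∑ j ∈ Finset.range k, e₁ j * x (0 + j) + ∑ j ∈ Finset.range k, e₂ j * x (k + j) +
        ∑ j ∈ Finset.range k, e₃ j * x (2 * k + j) +
        ∑ j ∈ Finset.range k, e₄ j * x (3 * k + j) := by
  rw [sum_fin_four_mul k (fun v => (if v < k then e₁ (v % k)
      else if v < 2 * k then e₂ (v % k)
      else if v < 3 * k then e₃ (v % k)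
      else e₄ (v % k)) * x v)]
  congr 1
  · congr 1
    · congr 1
      · refine Finset.sum_congr rfl fun j hj => ?_
        have hj := Finset.mem_range.mp hj
        simp [hj, Nat.mod_eq_of_lt hj]
      · refine Finset.sum_congr rfl fun j hj => ?_
        have hj := Finset.mem_range.mp hj
        rw [if_neg (by omega), if_pos (by omega), Nat.add_mod_left, Nat.mod_eq_of_lt hj]
    · refine Finset.sum_congr rfl fun j hj => ?_
      have hj := Finset.mem_range.mp hj
      rw [if_neg (by omega), if_neg (by omega), if_pos (by omega), Nat.mul_add_mod_self_right,
        Nat.mod_eq_of_lt hj]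
  · refine Finset.sum_congr rfl fun j hj => ?_
    have hj := Finset.mem_range.mp hj
    rw [if_neg (by omega), if_neg (by omega), if_neg (by omega), Nat.mul_add_mod_self_right,
      Nat.mod_eq_of_lt hj]

variable {k : ℕ} {r₁₁ r₁₂ r₁₃ r₁₄ r₂₁ r₂₂ r₂₃ r₂₄ : K[X]}

theorem sylBlockMatrix_mulVec_top
    (h₁ : r₁₁.natDegree ≤ k) (h₂ : r₁₂.natDegree ≤ k)
    (h₃ : r₁₃.natDegree ≤ k) (h₄ : r₁₄.natDegree ≤ k)
    (x : ℕ → K) (u : Fin (4 * k)) (hu : u.val < 2 * k) :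
    (sylBlockMatrix k r₁₁ r₁₂ r₁₃ r₁₄ r₂₁ r₂₂ r₂₃ r₂₄).mulVec (fun v => x v) u =
      (r₁₁ * polyOfSlice k x 0 + r₁₂ * polyOfSlice k x k +
        r₁₃ * polyOfSlice k x (2 * k) + r₁₄ * polyOfSlice k x (3 * k)).coeff u := by
  simp only [coeff_add, ← sum_sylBlockEntry_mul h₁, ← sum_sylBlockEntry_mul h₂,
    ← sum_sylBlockEntry_mul h₃, ← sum_sylBlockEntry_mul h₄]
  rw [← sum_four_blocks]
  simp only [Matrix.mulVec, dotProduct, sylBlockMatrix, Matrix.of_apply, if_pos hu]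

theorem sylBlockMatrix_mulVec_bot
    (h₁ : r₂₁.natDegree ≤ k) (h₂ : r₂₂.natDegree ≤ k)
    (h₃ : r₂₃.natDegree ≤ k) (h₄ : r₂₄.natDegree ≤ k)
    (x : ℕ → K) (u : Fin (4 * k)) (hu : ¬ u.val < 2 * k) :
    (sylBlockMatrix k r₁₁ r₁₂ r₁₃ r₁₄ r₂₁ r₂₂ r₂₃ r₂₄).mulVec (fun v => x v) u =
      (r₂₁ * polyOfSlice k x 0 + r₂₂ * polyOfSlice k x k +
        r₂₃ * polyOfSlice k x (2 * k) + r₂₄ * polyOfSlice k x (3 * k)).coeff (u - 2 * k) := by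
  simp only [coeff_add, ← sum_sylBlockEntry_mul h₁, ← sum_sylBlockEntry_mul h₂,
    ← sum_sylBlockEntry_mul h₃, ← sum_sylBlockEntry_mul h₄]
  rw [← sum_four_blocks]
  simp only [Matrix.mulVec, dotProduct, sylBlockMatrix, Matrix.of_apply, if_neg hu]

theorem natDegree_polyOfSlice_le (k : ℕ) (x : ℕ → K) (n : ℕ) :
    (polyOfSlice k x n).natDegree ≤ k - 1 := by
  rw [natDegree_le_iff_coeff_eq_zero]
  intro j hj
  rw [coeff_polyOfSlice, if_neg (by omega)]

/-- A singular block Sylvester matrix yields a nontrivial polynomial syzygy. -/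
theorem exists_syzygy_of_det_sylBlockMatrix_eq_zero
    (h₁₁ : r₁₁.natDegree ≤ k) (h₁₂ : r₁₂.natDegree ≤ k)
    (h₁₃ : r₁₃.natDegree ≤ k) (h₁₄ : r₁₄.natDegree ≤ k)
    (h₂₁ : r₂₁.natDegree ≤ k) (h₂₂ : r₂₂.natDegree ≤ k)
    (h₂₃ : r₂₃.natDegree ≤ k) (h₂₄ : r₂₄.natDegree ≤ k)
    (hdet : (sylBlockMatrix k r₁₁ r₁₂ r₁₃ r₁₄ r₂₁ r₂₂ r₂₃ r₂₄).det = 0) :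
    ∃ x₁ x₂ x₃ x₄ : K[X],
      (∀ n, k ≤ n → x₁.coeff n = 0) ∧ (∀ n, k ≤ n → x₂.coeff n = 0) ∧
      (∀ n, k ≤ n → x₃.coeff n = 0) ∧ (∀ n, k ≤ n → x₄.coeff n = 0) ∧
      ¬ (x₁ = 0 ∧ x₂ = 0 ∧ x₃ = 0 ∧ x₄ = 0) ∧
      r₁₁ * x₁ + r₁₂ * x₂ + r₁₃ * x₃ + r₁₄ * x₄ = 0 ∧
      r₂₁ * x₁ + r₂₂ * x₂ + r₂₃ * x₃ + r₂₄ * x₄ = 0 := by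
  obtain ⟨y, hy, hMy⟩ := Matrix.exists_mulVec_eq_zero_iff.mpr hdet
  obtain ⟨v₀, hv₀⟩ := Function.ne_iff.mp hy
  set x : ℕ → K := fun n => if h : n < 4 * k then y ⟨n, h⟩ else 0 with hx
  have hxy : (fun v : Fin (4 * k) => x v) = y := by
    funext v
    simp [hx]
  rw [← hxy] at hMy
  have hk : 0 < k := by have := v₀.isLt; omega
  have hvanish : ∀ n j, k ≤ j → (polyOfSlice k x n).coeff j = 0 := fun n j hj => by
    rw [coeff_polyOfSlice, if_neg (by omega)]
  have hdeg : ∀ {r : K[X]} (n : ℕ), r.natDegree ≤ k →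
      ∀ u, 2 * k ≤ u → (r * polyOfSlice k x n).coeff u = 0 := fun {r} n hr u hu => by
    have h1 := natDegree_polyOfSlice_le k x n
    have h2 := natDegree_mul_le (p := r) (q := polyOfSlice k x n)
    exact coeff_eq_zero_of_natDegree_lt (by omega)
  refine ⟨polyOfSlice k x 0, polyOfSlice k x k, polyOfSlice k x (2 * k), polyOfSlice k x (3 * k),
    hvanish _, hvanish _, hvanish _, hvanish _, ?_, ?_, ?_⟩
  · rintro ⟨z₁, z₂, z₃, z₄⟩
    apply hv₀
    have hslice : ∀ n j, polyOfSlice k x n = 0 → j < k → x (n + j) = 0 := fun n j h hj => by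
      have := coeff_polyOfSlice k x n j
      rwa [h, if_pos hj, coeff_zero, eq_comm] at this
    have hval : x v₀ = 0 := by
      have hlt := v₀.isLt
      by_cases c₁ : v₀.val < k
      · simpa using hslice 0 v₀ z₁ c₁
      by_cases c₂ : v₀.val < 2 * k
      · have := hslice k (v₀ - k) z₂ (by omega)
        rwa [show k + (v₀.val - k) = v₀ by omega] at this
      by_cases c₃ : v₀.val < 3 * k
      · have := hslice (2 * k) (v₀ - 2 * k) z₃ (by omega)
        rwa [show 2 * k + (v₀.val - 2 * k) = v₀ by omega] at this
      · have := hslice (3 * k) (v₀ - 3 * k) z₄ (by omega)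
        rwa [show 3 * k + (v₀.val - 3 * k) = v₀ by omega] at this
    rw [← hxy]
    exact hval
  · ext u
    by_cases hu : u < 2 * k
    · have := congrFun hMy ⟨u, by omega⟩
      rwa [sylBlockMatrix_mulVec_top h₁₁ h₁₂ h₁₃ h₁₄ x _ hu] at this
    · push Not at hu
      simp [hdeg _ h₁₁ u hu, hdeg _ h₁₂ u hu, hdeg _ h₁₃ u hu, hdeg _ h₁₄ u hu]
  · ext u
    by_cases hu : u < 2 * k
    · have := congrFun hMy ⟨2 * k + u, by omega⟩
      rw [sylBlockMatrix_mulVec_bot h₂₁ h₂₂ h₂₃ h₂₄ x _ (by simp)] at this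
      rwa [Nat.add_sub_cancel_left] at this
    · push Not at hu
      simp [hdeg _ h₂₁ u hu, hdeg _ h₂₂ u hu, hdeg _ h₂₃ u hu, hdeg _ h₂₄ u hu]

/-- The block Sylvester matrix is singular if a nonzero functional
`(p, q) ↦ v₁ L(p) + v₂ L(q)`, with `L(p) = ∑ φ u * p.coeff u`, annihilates all its columns. -/
theorem det_sylBlockMatrix_eq_zero_of_functional
    (h₁₁ : r₁₁.natDegree ≤ k) (h₁₂ : r₁₂.natDegree ≤ k)
    (h₁₃ : r₁₃.natDegree ≤ k) (h₁₄ : r₁₄.natDegree ≤ k)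
    (h₂₁ : r₂₁.natDegree ≤ k) (h₂₂ : r₂₂.natDegree ≤ k)
    (h₂₃ : r₂₃.natDegree ≤ k) (h₂₄ : r₂₄.natDegree ≤ k)
    (φ : ℕ → K) (hφ : ∃ u < 2 * k, φ u ≠ 0) (v₁ v₂ : K) (hv : ¬ (v₁ = 0 ∧ v₂ = 0))
    (L : K[X] → K) (hL : ∀ r : K[X], r.natDegree ≤ k → ∀ j < k,
      ∑ u ∈ Finset.range (2 * k), φ u * (r * X ^ j).coeff u = L (r * X ^ j))
    (e₁ : ∀ j < k, v₁ * L (r₁₁ * X ^ j) + v₂ * L (r₂₁ * X ^ j) = 0)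
    (e₂ : ∀ j < k, v₁ * L (r₁₂ * X ^ j) + v₂ * L (r₂₂ * X ^ j) = 0)
    (e₃ : ∀ j < k, v₁ * L (r₁₃ * X ^ j) + v₂ * L (r₂₃ * X ^ j) = 0)
    (e₄ : ∀ j < k, v₁ * L (r₁₄ * X ^ j) + v₂ * L (r₂₄ * X ^ j) = 0) :
    (sylBlockMatrix k r₁₁ r₁₂ r₁₃ r₁₄ r₂₁ r₂₂ r₂₃ r₂₄).det = 0 := by
  obtain ⟨u₀, hu₀, hφu₀⟩ := hφ
  have hk : 0 < k := by omega
  refine Matrix.exists_vecMul_eq_zero_iff.mp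
    ⟨fun u => if u.val < 2 * k then v₁ * φ u else v₂ * φ (u - 2 * k), ?_, ?_⟩
  · intro h
    apply hv
    constructor
    · have := congrFun h ⟨u₀, by omega⟩
      simpa [hu₀, hφu₀] using this
    · have := congrFun h ⟨2 * k + u₀, by omega⟩
      simpa [hφu₀] using this
  · have key : ∀ p q : K[X], p.natDegree ≤ k → q.natDegree ≤ k → ∀ j < k,
        ∑ u : Fin (4 * k), (if u.val < 2 * k then v₁ * φ u else v₂ * φ (u - 2 * k)) *
          (if u.val < 2 * k then sylBlockEntry k p u j else sylBlockEntry k q (u - 2 * k) j) =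
        v₁ * L (p * X ^ j) + v₂ * L (q * X ^ j) := by
      intro p q hp hq j hj
      rw [Fin.sum_univ_eq_sum_range (fun u => (if u < 2 * k then v₁ * φ u
        else v₂ * φ (u - 2 * k)) * (if u < 2 * k then sylBlockEntry k p u j
        else sylBlockEntry k q (u - 2 * k) j)), show 4 * k = 2 * k + 2 * k by ring,
        Finset.sum_range_add, ← hL p hp j hj, ← hL q hq j hj, Finset.mul_sum, Finset.mul_sum]
      congr 1
      · refine Finset.sum_congr rfl fun u hu => ?_
        rw [if_pos (Finset.mem_range.mp hu), if_pos (Finset.mem_range.mp hu),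
          sylBlockEntry_eq_coeff_mul_X_pow hp, mul_assoc]
      · refine Finset.sum_congr rfl fun u _ => ?_
        rw [if_neg (by omega), if_neg (by omega), Nat.add_sub_cancel_left,
          sylBlockEntry_eq_coeff_mul_X_pow hq, mul_assoc]
    funext v
    have hj := Nat.mod_lt v.val hk
    simp only [Matrix.vecMul, dotProduct, sylBlockMatrix, Matrix.of_apply, Pi.zero_apply]
    by_cases c₁ : v.val < k
    · simp only [if_pos c₁]
      rw [key _ _ h₁₁ h₂₁ _ hj, e₁ _ hj]
    by_cases c₂ : v.val < 2 * k
    · simp only [if_neg c₁, if_pos c₂]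
      rw [key _ _ h₁₂ h₂₂ _ hj, e₂ _ hj]
    by_cases c₃ : v.val < 3 * k
    · simp only [if_neg c₁, if_neg c₂, if_pos c₃]
      rw [key _ _ h₁₃ h₂₃ _ hj, e₃ _ hj]
    · simp only [if_neg c₁, if_neg c₂, if_neg c₃]
      rw [key _ _ h₁₄ h₂₄ _ hj, e₄ _ hj]

end SylvesterMatrix

section Curve

variable {K : Type*} [Field K]

/-- Weak Nullstellensatz in `K[t][s]`. -/
theorem exists_evalEval_eq_zero_of_ne_top [IsAlgClosed K] {I : Ideal K[X][X]} (hI : I ≠ ⊤) :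
    ∃ t s : K, ∀ p ∈ I, p.evalEval t s = 0 := by
  obtain ⟨m, hm, hIm⟩ := Ideal.exists_le_maximal I hI
  let _ : Field (K[X][X] ⧸ m) := Ideal.Quotient.field m
  have hft : Algebra.FiniteType K K[X][X] := Algebra.FiniteType.trans (S := K[X]) inferInstance
    inferInstance
  have : Algebra.FiniteType K (K[X][X] ⧸ m) := inferInstance
  have : Module.Finite K (K[X][X] ⧸ m) := finite_of_finite_type_of_isJacobsonRing K _
  have hbij := IsAlgClosed.algebraMap_bijective_of_isIntegral (k := K) (K := K[X][X] ⧸ m)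
  obtain ⟨t, ht⟩ := hbij.2 (Ideal.Quotient.mk m (C X))
  obtain ⟨s, hs⟩ := hbij.2 (Ideal.Quotient.mk m X)
  refine ⟨t, s, fun p hp => hbij.1 ?_⟩
  have hcomp : (algebraMap K (K[X][X] ⧸ m)).comp (evalEvalRingHom t s) = Ideal.Quotient.mk m := by
    ext r
    · simp [evalEvalRingHom]
      rfl
    · simpa [evalEvalRingHom] using ht
    · simpa [evalEvalRingHom] using hs
  rw [map_zero, ← coe_evalEvalRingHom, ← RingHom.comp_apply, hcomp]
  exact Ideal.Quotient.eq_zero_iff_mem.mpr (hIm hp)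

/-- The action of `√(f₁ f₂)` on the module with basis `√f₁`, `√f₂`. -/
def sqrtMatrix {R : Type*} [CommRing R] (f₁ f₂ : R) : Matrix (Fin 2) (Fin 2) R :=
  !![0, f₂; f₁, 0]

theorem sqrtMatrix_mul_self {R : Type*} [CommRing R] (f₁ f₂ : R) :
    sqrtMatrix f₁ f₂ * sqrtMatrix f₁ f₂ = algebraMap R _ (f₁ * f₂) := by
  ext i j
  fin_cases i <;> fin_cases j <;>
    simp [sqrtMatrix, Matrix.mul_apply, Matrix.algebraMap_matrix_apply, mul_comm]

open scoped Matrix in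
/-- A syzygy between `a + b√f` and `c + d√f` without common affine zeros is a multiple of the
Koszul syzygy. -/
theorem exists_koszul_of_no_common_zero [IsAlgClosed K] {f₁ f₂ a b c d x₁ x₂ y₁ y₂ : K[X]}
    (hno : ∀ t s : K, s ^ 2 = (f₁ * f₂).eval t → a.eval t + b.eval t * s = 0 →
      c.eval t + d.eval t * s ≠ 0)
    (h₁ : a * x₁ + b * f₂ * x₂ + c * y₁ + d * f₂ * y₂ = 0)
    (h₂ : b * f₁ * x₁ + a * x₂ + d * f₁ * y₁ + c * y₂ = 0) :
    ∃ z₁ z₂ : K[X], x₁ = c * z₁ + d * f₂ * z₂ ∧ x₂ = d * f₁ * z₁ + c * z₂ ∧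
      y₁ = -(a * z₁ + b * f₂ * z₂) ∧ y₂ = -(b * f₁ * z₁ + a * z₂) := by
  let q : K[X][X] := X ^ 2 - C (f₁ * f₂)
  let A : K[X][X] := C a + C b * X
  let B : K[X][X] := C c + C d * X
  have htop : Ideal.span {A, B, q} = ⊤ := by
    by_contra hne
    obtain ⟨t, s, hts⟩ := exists_evalEval_eq_zero_of_ne_top hne
    have hA := hts A (Ideal.subset_span (by simp))
    have hB := hts B (Ideal.subset_span (by simp))
    have hq := hts q (Ideal.subset_span (by simp))
    simp only [A, B, q, evalEval, eval_add, eval_sub, eval_mul, eval_C, eval_X, eval_pow]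
      at hA hB hq
    exact hno t s (by rw [eval_mul]; linear_combination hq) hA hB
  obtain ⟨U, V, W, hUVW⟩ : ∃ U V W, U * A + V * B + W * q = 1 := by
    have h1 : (1 : K[X][X]) ∈ Ideal.span {A, B, q} := htop ▸ Submodule.mem_top
    obtain ⟨U, z, hz, h⟩ := Ideal.mem_span_insert.mp h1
    obtain ⟨V, W, h'⟩ := Ideal.mem_span_pair.mp hz
    exact ⟨U, V, W, by rw [h, ← h']; ring⟩
  let φ := aeval (R := K[X]) (sqrtMatrix f₁ f₂)
  have hq : φ q = 0 := by
    simp [φ, q, sq, sqrtMatrix_mul_self]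
  have hA : φ A = !![a, b * f₂; b * f₁, a] := by
    ext i j
    fin_cases i <;> fin_cases j <;>
      simp [φ, A, sqrtMatrix, Matrix.algebraMap_matrix_apply, Matrix.mul_apply]
  have hB : φ B = !![c, d * f₂; d * f₁, c] := by
    ext i j
    fin_cases i <;> fin_cases j <;>
      simp [φ, B, sqrtMatrix, Matrix.algebraMap_matrix_apply, Matrix.mul_apply]
  have hone : φ U * φ A + φ V * φ B = 1 := by
    simpa [hq] using congrArg φ hUVW
  have hcomm : ∀ p r, φ p * φ r = φ r * φ p := fun p r => by
    rw [← map_mul, mul_comm, map_mul]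
  have hsyz : φ A *ᵥ ![x₁, x₂] = -(φ B *ᵥ ![y₁, y₂]) := by
    rw [hA, hB]
    funext i
    fin_cases i
    · simp [Matrix.mulVec, dotProduct, Fin.sum_univ_two]
      linear_combination h₁
    · simp [Matrix.mulVec, dotProduct, Fin.sum_univ_two]
      linear_combination h₂
  have hx : ![x₁, x₂] = φ B *ᵥ (φ V *ᵥ ![x₁, x₂] - φ U *ᵥ ![y₁, y₂]) := by
    calc ![x₁, x₂] = (φ U * φ A + φ V * φ B) *ᵥ ![x₁, x₂] := by rw [hone, Matrix.one_mulVec]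
      _ = _ := by
        rw [Matrix.add_mulVec, ← Matrix.mulVec_mulVec, hsyz, Matrix.mulVec_neg,
          Matrix.mulVec_sub, Matrix.mulVec_mulVec, Matrix.mulVec_mulVec, Matrix.mulVec_mulVec,
          hcomm B V, hcomm B U]
        abel
  have hy : ![y₁, y₂] = -(φ A *ᵥ (φ V *ᵥ ![x₁, x₂] - φ U *ᵥ ![y₁, y₂])) := by
    calc ![y₁, y₂] = (φ U * φ A + φ V * φ B) *ᵥ ![y₁, y₂] := by rw [hone, Matrix.one_mulVec]
      _ = _ := by
        rw [Matrix.add_mulVec, ← Matrix.mulVec_mulVec _ (φ V),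
          ← neg_eq_iff_eq_neg.mpr hsyz, Matrix.mulVec_neg,
          Matrix.mulVec_sub, Matrix.mulVec_mulVec, Matrix.mulVec_mulVec, Matrix.mulVec_mulVec,
          hcomm A V, hcomm A U]
        abel
  set z := φ V *ᵥ ![x₁, x₂] - φ U *ᵥ ![y₁, y₂]
  rw [hB] at hx
  rw [hA] at hy
  refine ⟨z 0, z 1, ?_, ?_, ?_, ?_⟩
  · simpa [Matrix.mulVec, dotProduct, Fin.sum_univ_two] using congrFun hx 0
  · simpa [Matrix.mulVec, dotProduct, Fin.sum_univ_two] using congrFun hx 1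
  · have := congrFun hy 0
    simp [dotProduct, Fin.sum_univ_two] at this
    rw [this]; ring
  · have := congrFun hy 1
    simp [dotProduct, Fin.sum_univ_two] at this
    rw [this]; ring

/-- If `α + βS` and `γ + δS` kill a common nonzero vector, where `S` is the matrix
`!![0, φ₂; φ₁, 0]`, then they vanish together at an eigenvalue of `S`. -/
theorem exists_common_eigenvalue [IsAlgClosed K] {φ₁ φ₂ α β γ δ ζ₁ ζ₂ : K}
    (hζ : ¬ (ζ₁ = 0 ∧ ζ₂ = 0))
    (h₁ : α * ζ₁ + β * φ₂ * ζ₂ = 0) (h₂ : β * φ₁ * ζ₁ + α * ζ₂ = 0)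
    (h₃ : γ * ζ₁ + δ * φ₂ * ζ₂ = 0) (h₄ : δ * φ₁ * ζ₁ + γ * ζ₂ = 0) :
    ∃ w : K, w ^ 2 = φ₁ * φ₂ ∧ α + w * β = 0 ∧ γ + w * δ = 0 := by
  obtain ⟨w, hw⟩ := IsAlgClosed.exists_pow_nat_eq (φ₁ * φ₂) (n := 2) (by norm_num)
  have cancel : ∀ {v₁ v₂ e : K}, ¬ (v₁ = 0 ∧ v₂ = 0) → e * v₁ = 0 → e * v₂ = 0 → e = 0 := by
    intro v₁ v₂ e hv he₁ he₂
    by_contra he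
    exact hv ⟨(mul_eq_zero.mp he₁).resolve_left he, (mul_eq_zero.mp he₂).resolve_left he⟩
  by_cases hv : φ₂ * ζ₂ + w * ζ₁ = 0 ∧ φ₁ * ζ₁ + w * ζ₂ = 0
  · obtain ⟨hv₁, hv₂⟩ := hv
    refine ⟨-w, by rw [neg_sq, hw], cancel hζ ?_ ?_, cancel hζ ?_ ?_⟩
    · linear_combination h₁ - β * hv₁
    · linear_combination h₂ - β * hv₂
    · linear_combination h₃ - δ * hv₁
    · linear_combination h₄ - δ * hv₂
  · refine ⟨w, hw, cancel hv ?_ ?_, cancel hv ?_ ?_⟩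
    · linear_combination w * h₁ + φ₂ * h₂ + β * ζ₁ * hw
    · linear_combination w * h₂ + φ₁ * h₁ + β * ζ₂ * hw
    · linear_combination w * h₃ + φ₂ * h₄ + δ * ζ₁ * hw
    · linear_combination w * h₄ + φ₁ * h₃ + δ * ζ₂ * hw

/-- A left eigenvector of `!![0, φ₂; φ₁, 0]` with eigenvalue a square root of `φ₁ * φ₂`. -/
theorem exists_left_eigenvector {φ₁ φ₂ w : K} (hw : w ^ 2 = φ₁ * φ₂) :
    ∃ v₁ v₂ : K, ¬ (v₁ = 0 ∧ v₂ = 0) ∧ v₂ * φ₁ = w * v₁ ∧ v₁ * φ₂ = w * v₂ := by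
  by_cases h : φ₁ = 0 ∧ w = 0
  · by_cases h' : φ₂ = 0
    · exact ⟨1, 0, by simp, by simp [h], by simp [h, h']⟩
    · exact ⟨w, φ₂, by simp [h'], by linear_combination -hw, by ring⟩
  · exact ⟨φ₁, w, h, by ring, by linear_combination -hw⟩

end Curve

section SylvesterFormula

variable {K : Type*} [Field K] {m k : ℕ} {f₁ f₂ a b c d : K[X]}

theorem natDegree_mul_le_of_le_sub {p q : K[X]} (hmk : m ≤ k) (hp : p.natDegree ≤ k - m)
    (hq : q.natDegree ≤ m) : (p * q).natDegree ≤ k := by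
  have := natDegree_mul_le (p := p) (q := q)
  omega

theorem coeff_mul_of_le_sub {p q : K[X]} (hmk : m ≤ k) (hp : p.natDegree ≤ k - m)
    (hq : q.natDegree ≤ m) : (p * q).coeff k = p.coeff (k - m) * q.coeff m := by
  rw [← coeff_mul_add_eq_of_natDegree_le hp hq, Nat.sub_add_cancel hmk]

theorem det_sylBlockMatrix_eq_zero_of_affine_zero (hk : 0 < k) (hmk : m ≤ k)
    (hf₁ : f₁.natDegree ≤ m) (hf₂ : f₂.natDegree ≤ m)
    (ha : a.natDegree ≤ k) (hc : c.natDegree ≤ k)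
    (hb : b.natDegree ≤ k - m) (hd : d.natDegree ≤ k - m) {t s : K}
    (hs : s ^ 2 = (f₁ * f₂).eval t) (hA : a.eval t + b.eval t * s = 0)
    (hB : c.eval t + d.eval t * s = 0) :
    (sylBlockMatrix k a (b * f₂) c (d * f₂) (b * f₁) a (d * f₁) c).det = 0 := by
  rw [eval_mul] at hs
  obtain ⟨v₁, v₂, hv, hv₁, hv₂⟩ := exists_left_eigenvector hs
  refine det_sylBlockMatrix_eq_zero_of_functional ha (natDegree_mul_le_of_le_sub hmk hb hf₂) hc
    (natDegree_mul_le_of_le_sub hmk hd hf₂) (natDegree_mul_le_of_le_sub hmk hb hf₁) ha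
    (natDegree_mul_le_of_le_sub hmk hd hf₁) hc (fun u => t ^ u) ⟨0, by omega, by simp⟩ v₁ v₂ hv
    (eval t) ?_ ?_ ?_ ?_ ?_
  · intro r hr j hj
    have h := natDegree_mul_le (p := r) (q := X ^ j)
    rw [natDegree_X_pow] at h
    rw [eval_eq_sum_range' (n := 2 * k) (by omega)]
    exact Finset.sum_congr rfl fun u _ => mul_comm _ _
  all_goals
    intro j _
    simp only [eval_mul, eval_pow, eval_X]
  · linear_combination t ^ j * (v₁ * hA + b.eval t * hv₁)
  · linear_combination t ^ j * (v₂ * hA + b.eval t * hv₂)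
  · linear_combination t ^ j * (v₁ * hB + d.eval t * hv₁)
  · linear_combination t ^ j * (v₂ * hB + d.eval t * hv₂)

theorem det_sylBlockMatrix_eq_zero_of_zero_at_infinity (hk : 0 < k) (hmk : m ≤ k)
    (hf₁ : f₁.natDegree ≤ m) (hf₂ : f₂.natDegree ≤ m)
    (ha : a.natDegree ≤ k) (hc : c.natDegree ≤ k)
    (hb : b.natDegree ≤ k - m) (hd : d.natDegree ≤ k - m) {w : K}
    (hw : w ^ 2 = f₁.coeff m * f₂.coeff m) (hA : a.coeff k + w * b.coeff (k - m) = 0)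
    (hB : c.coeff k + w * d.coeff (k - m) = 0) :
    (sylBlockMatrix k a (b * f₂) c (d * f₂) (b * f₁) a (d * f₁) c).det = 0 := by
  obtain ⟨v₁, v₂, hv, hv₁, hv₂⟩ := exists_left_eigenvector hw
  have hbf₁ := natDegree_mul_le_of_le_sub hmk hb hf₁
  have hbf₂ := natDegree_mul_le_of_le_sub hmk hb hf₂
  have hdf₁ := natDegree_mul_le_of_le_sub hmk hd hf₁
  have hdf₂ := natDegree_mul_le_of_le_sub hmk hd hf₂
  have top : ∀ {p q : K[X]}, p.natDegree ≤ k → q.natDegree ≤ k →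
      v₁ * p.coeff k + v₂ * q.coeff k = 0 → ∀ j < k,
      v₁ * (p * X ^ j).coeff (2 * k - 1) + v₂ * (q * X ^ j).coeff (2 * k - 1) = 0 := by
    intro p q hp hq h j hj
    rw [coeff_mul_X_pow', coeff_mul_X_pow', if_pos (by omega), if_pos (by omega)]
    by_cases hjk : j = k - 1
    · rwa [show 2 * k - 1 - j = k by omega]
    · rw [coeff_eq_zero_of_natDegree_lt (by omega), coeff_eq_zero_of_natDegree_lt (by omega)]
      simp
  refine det_sylBlockMatrix_eq_zero_of_functional ha hbf₂ hc hdf₂ hbf₁ ha hdf₁ hc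
    (fun u => if u = 2 * k - 1 then 1 else 0) ⟨2 * k - 1, by omega, by simp⟩ v₁ v₂ hv
    (coeff · (2 * k - 1)) ?_ (top ha hbf₁ ?_) (top hbf₂ ha ?_) (top hc hdf₁ ?_) (top hdf₂ hc ?_)
  · intro r _ j _
    simp only [ite_mul, one_mul, zero_mul, Finset.sum_ite_eq', Finset.mem_range]
    rw [if_pos (by omega)]
  · rw [coeff_mul_of_le_sub hmk hb hf₁]
    linear_combination v₁ * hA + b.coeff (k - m) * hv₁
  · rw [coeff_mul_of_le_sub hmk hb hf₂]
    linear_combination v₂ * hA + b.coeff (k - m) * hv₂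
  · rw [coeff_mul_of_le_sub hmk hd hf₁]
    linear_combination v₁ * hB + d.coeff (k - m) * hv₁
  · rw [coeff_mul_of_le_sub hmk hd hf₂]
    linear_combination v₂ * hB + d.coeff (k - m) * hv₂

theorem exists_zero_at_infinity_of_det_sylBlockMatrix_eq_zero [IsAlgClosed K] (hmk : m ≤ k)
    (hf₁ : f₁.natDegree ≤ m) (hf₂ : f₂.natDegree ≤ m)
    (ha : a.natDegree ≤ k) (hc : c.natDegree ≤ k)
    (hb : b.natDegree ≤ k - m) (hd : d.natDegree ≤ k - m)
    (hno : ∀ t s : K, s ^ 2 = (f₁ * f₂).eval t → a.eval t + b.eval t * s = 0 →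
      c.eval t + d.eval t * s ≠ 0)
    (hdet : (sylBlockMatrix k a (b * f₂) c (d * f₂) (b * f₁) a (d * f₁) c).det = 0) :
    ∃ w : K, w ^ 2 = f₁.coeff m * f₂.coeff m ∧ a.coeff k + w * b.coeff (k - m) = 0 ∧
      c.coeff k + w * d.coeff (k - m) = 0 := by
  have hbf₁ := natDegree_mul_le_of_le_sub hmk hb hf₁
  have hbf₂ := natDegree_mul_le_of_le_sub hmk hb hf₂
  have hdf₁ := natDegree_mul_le_of_le_sub hmk hd hf₁
  have hdf₂ := natDegree_mul_le_of_le_sub hmk hd hf₂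
  obtain ⟨x₁, x₂, y₁, y₂, hx₁, hx₂, hy₁, hy₂, hne, h₁, h₂⟩ :=
    exists_syzygy_of_det_sylBlockMatrix_eq_zero ha hbf₂ hc hdf₂ hbf₁ ha hdf₁ hc hdet
  obtain ⟨z₁, z₂, rfl, rfl, rfl, rfl⟩ := exists_koszul_of_no_common_zero hno h₁ h₂
  set n := max z₁.natDegree z₂.natDegree with hn
  have hz₁ : z₁.natDegree ≤ n := le_max_left _ _
  have hz₂ : z₂.natDegree ≤ n := le_max_right _ _
  have hζ : ¬ (z₁.coeff n = 0 ∧ z₂.coeff n = 0) := by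
    rintro ⟨h0, h0'⟩
    apply hne
    have hz : z₁ = 0 ∧ z₂ = 0 := by
      rcases le_total z₁.natDegree z₂.natDegree with hle | hle
      · rw [hn, max_eq_right hle] at h0'
        have hz₂0 : z₂ = 0 := leadingCoeff_eq_zero.mp h0'
        rw [hn, max_eq_right hle, hz₂0, natDegree_zero] at h0
        rw [hz₂0, natDegree_zero, Nat.le_zero] at hle
        exact ⟨leadingCoeff_eq_zero.mp (by rwa [leadingCoeff, hle]), hz₂0⟩
      · rw [hn, max_eq_left hle] at h0
        have hz₁0 : z₁ = 0 := leadingCoeff_eq_zero.mp h0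
        rw [hn, max_eq_left hle, hz₁0, natDegree_zero] at h0'
        rw [hz₁0, natDegree_zero, Nat.le_zero] at hle
        exact ⟨hz₁0, leadingCoeff_eq_zero.mp (by rwa [leadingCoeff, hle])⟩
    simp [hz.1, hz.2]
  have e₁ := hy₁ (k + n) (Nat.le_add_right _ _)
  have e₂ := hy₂ (k + n) (Nat.le_add_right _ _)
  have e₃ := hx₁ (k + n) (Nat.le_add_right _ _)
  have e₄ := hx₂ (k + n) (Nat.le_add_right _ _)
  rw [coeff_neg, neg_eq_zero, coeff_add, coeff_mul_add_eq_of_natDegree_le ha hz₁,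
    coeff_mul_add_eq_of_natDegree_le hbf₂ hz₂, coeff_mul_of_le_sub hmk hb hf₂] at e₁
  rw [coeff_neg, neg_eq_zero, coeff_add, coeff_mul_add_eq_of_natDegree_le hbf₁ hz₁,
    coeff_mul_add_eq_of_natDegree_le ha hz₂, coeff_mul_of_le_sub hmk hb hf₁] at e₂
  rw [coeff_add, coeff_mul_add_eq_of_natDegree_le hc hz₁,
    coeff_mul_add_eq_of_natDegree_le hdf₂ hz₂, coeff_mul_of_le_sub hmk hd hf₂] at e₃
  rw [coeff_add, coeff_mul_add_eq_of_natDegree_le hdf₁ hz₁,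
    coeff_mul_add_eq_of_natDegree_le hc hz₂, coeff_mul_of_le_sub hmk hd hf₁] at e₄
  exact exists_common_eigenvalue hζ e₁ e₂ e₃ e₄

end SylvesterFormula

/-- **Hyperelliptic Sylvester formula.**
In the hyperelliptic setup (`f = f⁽¹⁾f⁽²⁾` squarefree of degree `2g+2`, factors of
degree `g+1`, `k ≥ g+1`, `deg a, deg c ≤ k`, `deg b, deg d ≤ k−g−1`, `(a,b)` and
`(c,d)` linearly independent), the determinant of the `4k × 4k` block matrix
`[[syl(k,a), syl(k,bf⁽²⁾), syl(k,c), syl(k,df⁽²⁾)], [syl(k,bf⁽¹⁾), syl(k,a),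
syl(k,df⁽¹⁾), syl(k,c)]]` vanishes iff `a+b√f` and `c+d√f` have a common zero on
the hyperelliptic curve `s² = f(t)` (including at infinity). -/
theorem hyperelliptic_sylvester_formula
    {K : Type*} [Field K] [IsAlgClosed K] (hchar : ringChar K ≠ 2)
    (g k : ℕ) (f f1 f2 a b c d : Polynomial K)
    (hsqf : Squarefree f) (hdegf : f.natDegree = 2 * g + 2)
    (hfact : f = f1 * f2) (hdegf1 : f1.natDegree = g + 1) (hdegf2 : f2.natDegree = g + 1)
    (hk : g + 1 ≤ k)
    (hdega : a.natDegree ≤ k) (hdegc : c.natDegree ≤ k)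
    (hdegb : b.natDegree ≤ k - (g + 1)) (hdegd : d.natDegree ≤ k - (g + 1))
    (hindep : ∀ lam mu : K, lam • a = mu • c → lam • b = mu • d → lam = 0 ∧ mu = 0) :
    (sylBlockMatrix k a (b * f2) c (d * f2) (b * f1) a (d * f1) c).det = 0
    ↔ (∃ t0 s0 : K, s0 ^ 2 = f.eval t0 ∧
          a.eval t0 + b.eval t0 * s0 = 0 ∧ c.eval t0 + d.eval t0 * s0 = 0) ∨
      (∃ w : K, w ^ 2 = f.coeff (2 * g + 2) ∧
          a.coeff k + w * b.coeff (k - (g + 1)) = 0 ∧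
          c.coeff k + w * d.coeff (k - (g + 1)) = 0) := by
  subst hfact
  have htop : (f1 * f2).coeff (2 * g + 2) = f1.coeff (g + 1) * f2.coeff (g + 1) := by
    rw [← coeff_mul_add_eq_of_natDegree_le hdegf1.le hdegf2.le]
    congr 1
    ring
  rw [htop]
  constructor
  · intro hdet
    by_cases hno : ∃ t0 s0 : K, s0 ^ 2 = (f1 * f2).eval t0 ∧
        a.eval t0 + b.eval t0 * s0 = 0 ∧ c.eval t0 + d.eval t0 * s0 = 0
    · exact Or.inl hno
    · exact Or.inr (exists_zero_at_infinity_of_det_sylBlockMatrix_eq_zero hk hdegf1.le hdegf2.le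
        hdega hdegc hdegb hdegd (fun t s hs hA hB => hno ⟨t, s, hs, hA, hB⟩) hdet)
  · rintro (⟨t, s, hs, hA, hB⟩ | ⟨w, hw, hA, hB⟩)
    · exact det_sylBlockMatrix_eq_zero_of_affine_zero (by omega) hk hdegf1.le hdegf2.le
        hdega hdegc hdegb hdegd hs hA hB
    · exact det_sylBlockMatrix_eq_zero_of_zero_at_infinity (by omega) hk hdegf1.le hdegf2.le
        hdega hdegc hdegb hdegd hw hA hB
end

section
/- Assume the hyperelliptic setup of the context, and assume additionally k ≤ 12. Form the 2×(3k+3) matrix whose first row is (a_0,…,a_k, (bf⁽¹⁾)_0,…,(bf⁽¹⁾)_k, (bf⁽²⁾)_0,…,(bf⁽²⁾)_k) and whose second row is (c_0,…,c_k, (df⁽¹⁾)_0,…,(df⁽¹⁾)_k, (df⁽²⁾)_0,…,(df⁽²⁾)_k); for column indices u, v let [u,v] denote its 2×2 minor on columns u and v; for 0 ≤ p ≤ k write p for column p, p⁽¹⁾ for column p+(k+1), and p⁽²⁾ for column p+2(k+1). Define k×k matrices (indices 1 ≤ i,j ≤ k): A¹¹_{ij} = Σ_{0≤p<q≤k, p<min(i,j),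 p+q=i+j−1} ([p⁽²⁾,q]+[p,q⁽²⁾]); A¹²_{ij} = Σ_{0≤p<q≤k, p<min(i,j), p+q=i+j−1} [p,q] + Σ_{0≤p,q≤k, p<j, p+q=i+j−1} [p⁽¹⁾,q⁽²⁾]; A²¹_{ij} = Σ_{0≤p<q≤k, p<min(i,j), p+q=i+j−1} [p,q] + Σ_{0≤p,q≤k, p<j, p+q=i+j−1} [p⁽²⁾,q⁽¹⁾]; A²²_{ij} = Σ_{0≤p<q≤k, p<min(i,j), p+q=i+j−1} ([p⁽¹⁾,q]+[p,q⁽¹⁾]). Let A be the 2k×2k block matrix [[A¹¹, A¹²],[A²¹, A²²]]. Then det A = 0 if and only if the functions a+b√f and c+d√f have a common zero on the hyperelliptic curve s² = f(t) (affine common zero, or common zero at infinity as defined in the context). -/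
open Polynomial

/-- The `u`-th entry (0-based, `0 ≤ u < 3(k+1)`) of a row
`(r_0,…,r_k, (sf⁽¹⁾)_0,…,(sf⁽¹⁾)_k, (sf⁽²⁾)_0,…,(sf⁽²⁾)_k)` of the paper's
`2 × (3k+3)` matrix, built from polynomials `r`, `s` and the factors `f⁽¹⁾, f⁽²⁾`. -/
noncomputable def heRow {K : Type*} [CommRing K] (k : ℕ) (r s f1 f2 : Polynomial K) (u : ℕ) : K :=
  if u < k + 1 then r.coeff u
  else if u < 2 * (k + 1) then (s * f1).coeff (u - (k + 1))
  else (s * f2).coeff (u - 2 * (k + 1))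

/-- The 2×2 minor `[u,v]` on columns `u`, `v` of the `2 × (3k+3)` matrix with rows
`(a_*, (bf⁽¹⁾)_*, (bf⁽²⁾)_*)` and `(c_*, (df⁽¹⁾)_*, (df⁽²⁾)_*)`. -/
noncomputable def heMinor {K : Type*} [CommRing K] (k : ℕ) (a b c d f1 f2 : Polynomial K) (u v : ℕ) : K :=
  heRow k a b f1 f2 u * heRow k c d f1 f2 v - heRow k a b f1 f2 v * heRow k c d f1 f2 u

/-- Entry `(i,j)` (1-indexed `i, j`, here given as naturals) of the block `A¹¹`. -/
noncomputable def heA11 {K : Type*} [CommRing K] (k : ℕ) (a b c d f1 f2 : Polynomial K) (i j : ℕ) : K :=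
  ∑ p ∈ Finset.range (k + 1), ∑ q ∈ Finset.range (k + 1),
    if p < q ∧ p ≤ min i j ∧ p + q = i + j + 1 then
      heMinor k a b c d f1 f2 (p + 2 * (k + 1)) q +
        heMinor k a b c d f1 f2 p (q + 2 * (k + 1))
    else 0

/-- Entry `(i,j)` of the block `A¹²`. -/
noncomputable def heA12 {K : Type*} [CommRing K] (k : ℕ) (a b c d f1 f2 : Polynomial K) (i j : ℕ) : K :=
  (∑ p ∈ Finset.range (k + 1), ∑ q ∈ Finset.range (k + 1),
    if p < q ∧ p ≤ min i j ∧ p + q = i + j + 1 then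
      heMinor k a b c d f1 f2 p q
    else 0) +
  ∑ p ∈ Finset.range (k + 1), ∑ q ∈ Finset.range (k + 1),
    if p ≤ j ∧ p + q = i + j + 1 then
      heMinor k a b c d f1 f2 (p + (k + 1)) (q + 2 * (k + 1))
    else 0

/-- Entry `(i,j)` of the block `A²¹`. -/
noncomputable def heA21 {K : Type*} [CommRing K] (k : ℕ) (a b c d f1 f2 : Polynomial K) (i j : ℕ) : K :=
  (∑ p ∈ Finset.range (k + 1), ∑ q ∈ Finset.range (k + 1),
    if p < q ∧ p ≤ min i j ∧ p + q = i + j + 1 then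
      heMinor k a b c d f1 f2 p q
    else 0) +
  ∑ p ∈ Finset.range (k + 1), ∑ q ∈ Finset.range (k + 1),
    if p ≤ j ∧ p + q = i + j + 1 then
      heMinor k a b c d f1 f2 (p + 2 * (k + 1)) (q + (k + 1))
    else 0

/-- Entry `(i,j)` of the block `A²²`. -/
noncomputable def heA22 {K : Type*} [CommRing K] (k : ℕ) (a b c d f1 f2 : Polynomial K) (i j : ℕ) : K :=
  ∑ p ∈ Finset.range (k + 1), ∑ q ∈ Finset.range (k + 1),
    if p < q ∧ p ≤ min i j ∧ p + q = i + j + 1 then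
      heMinor k a b c d f1 f2 (p + (k + 1)) q +
        heMinor k a b c d f1 f2 p (q + (k + 1))
    else 0

/-- The `2k × 2k` block matrix `A = [[A¹¹, A¹²],[A²¹, A²²]]`. -/
noncomputable def heBezoutMatrix {K : Type*} [CommRing K] (k : ℕ) (a b c d f1 f2 : Polynomial K) :
    Matrix (Fin (2 * k)) (Fin (2 * k)) K :=
  Matrix.of fun u v =>
    if u.val < k then
      if v.val < k then heA11 k a b c d f1 f2 u.val v.val
      else heA12 k a b c d f1 f2 u.val (v.val - k)
    else
      if v.val < k then heA21 k a b c d f1 f2 (u.val - k) v.val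
      else heA22 k a b c d f1 f2 (u.val - k) (v.val - k)

theorem exists_cofactors_of_no_common_zero {K : Type*} [Field K] [IsAlgClosed K]
    {f a b c d : K[X]}
    (h : ∀ t s : K, s ^ 2 = f.eval t → a.eval t + b.eval t * s = 0 →
      c.eval t + d.eval t * s ≠ 0) :
    ∃ u₀ u₁ v₀ v₁ : K[X], u₀ * a + u₁ * b * f + v₀ * c + v₁ * d * f = 1 ∧
      u₀ * b + u₁ * a + v₀ * d + v₁ * c = 0 := by
  let F : QuadraticAlgebra K[X] f 0 := ⟨a, b⟩
  let H : QuadraticAlgebra K[X] f 0 := ⟨c, d⟩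
  by_cases htop : Ideal.span {F, H} = ⊤
  · rw [Ideal.eq_top_iff_one, Ideal.mem_span_pair] at htop
    obtain ⟨u, v, huv⟩ := htop
    refine ⟨u.re, u.im, v.re, v.im, ?_, ?_⟩
    · have := congrArg QuadraticAlgebra.re huv
      simp only [QuadraticAlgebra.re_add, QuadraticAlgebra.re_mul, QuadraticAlgebra.re_one,
        F, H] at this
      linear_combination this
    · have := congrArg QuadraticAlgebra.im huv
      simp only [QuadraticAlgebra.im_add, QuadraticAlgebra.im_mul, QuadraticAlgebra.im_one,
        F, H] at this
      linear_combination this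
  · exfalso
    obtain ⟨m, hm, hle⟩ := Ideal.exists_le_maximal _ htop
    let _ : Field (QuadraticAlgebra K[X] f 0 ⧸ m) := Ideal.Quotient.field m
    have : Algebra.FiniteType K (QuadraticAlgebra K[X] f 0) :=
      Algebra.FiniteType.trans (S := K[X]) inferInstance inferInstance
    have : Module.Finite K (QuadraticAlgebra K[X] f 0 ⧸ m) :=
      finite_of_finite_type_of_isJacobsonRing K _
    let e := AlgEquiv.ofBijective (Algebra.ofId K (QuadraticAlgebra K[X] f 0 ⧸ m))
      IsAlgClosed.algebraMap_bijective_of_isIntegral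
    let φ : QuadraticAlgebra K[X] f 0 →ₐ[K] K :=
      e.symm.toAlgHom.comp (Ideal.Quotient.mkₐ K m)
    let ψ : K[X] →ₐ[K] K := φ.comp (IsScalarTower.toAlgHom K K[X] _)
    have hψ : ∀ p : K[X], φ (algebraMap _ _ p) = p.eval (ψ X) := by
      intro p
      have : ψ = aeval (ψ X) := by ext; simp
      calc φ (algebraMap _ _ p) = ψ p := rfl
        _ = p.eval (ψ X) := by rw [this]; simp [aeval_def, eval₂_eq_eval_map]
    have hlin : ∀ p q : K[X], φ ⟨p, q⟩ = p.eval (ψ X) + q.eval (ψ X) * φ ⟨0, 1⟩ := by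
      intro p q
      rw [← hψ, ← hψ, ← map_mul, ← map_add]
      congr 1
      ext <;> simp [QuadraticAlgebra.algebraMap_eq]
    have hker : ∀ z ∈ m, φ z = 0 := by
      intro z hz
      simp [φ, Ideal.Quotient.eq_zero_iff_mem.mpr hz]
    refine h (ψ X) (φ ⟨0, 1⟩) ?_ ?_ ?_
    · rw [← map_pow, ← hψ]
      congr 1
      ext <;> simp [QuadraticAlgebra.algebraMap_eq, pow_two]
    · rw [← hlin]
      exact hker _ (hle (Ideal.subset_span (by simp [F])))
    · rw [← hlin]
      exact hker _ (hle (Ideal.subset_span (by simp [H])))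

theorem exists_sq_eq_of_common_kernel {K : Type*} [Field K] [IsAlgClosed K]
    {α β γ δ l₁ l₂ x y : K} (hl₂ : l₂ ≠ 0) (hxy : x ≠ 0 ∨ y ≠ 0)
    (h₁ : α * x + β * l₂ * y = 0) (h₂ : α * y + β * l₁ * x = 0)
    (h₃ : γ * x + δ * l₂ * y = 0) (h₄ : γ * y + δ * l₁ * x = 0) :
    ∃ w, w ^ 2 = l₁ * l₂ ∧ α + w * β = 0 ∧ γ + w * δ = 0 := by
  obtain ⟨w, hw⟩ := IsAlgClosed.exists_pow_nat_eq (l₁ * l₂) (n := 2) (by norm_num)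
  by_cases hX : l₂ * y + w * x = 0
  · have hx : x ≠ 0 := by
      rintro rfl
      simp_all
    refine ⟨-w, by rw [neg_sq, hw], ?_, ?_⟩
    · exact (mul_eq_zero.mp (by linear_combination h₁ - β * hX :
        (α + -w * β) * x = 0)).resolve_right hx
    · exact (mul_eq_zero.mp (by linear_combination h₃ - δ * hX :
        (γ + -w * δ) * x = 0)).resolve_right hx
  · refine ⟨w, hw, ?_, ?_⟩
    · exact (mul_eq_zero.mp (by linear_combination w * h₁ + l₂ * h₂ + β * x * hw :
        (α + w * β) * (l₂ * y + w * x) = 0)).resolve_right hX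
    · exact (mul_eq_zero.mp (by linear_combination w * h₃ + l₂ * h₄ + δ * x * hw :
        (γ + w * δ) * (l₂ * y + w * x) = 0)).resolve_right hX

theorem eq_zero_of_degree_mul_lt {K : Type*} [Field K] [IsAlgClosed K]
    {m n : ℕ} {f₁ f₂ a b c d x y : K[X]}
    (hf₁ : f₁.natDegree = m) (hf₂ : f₂.natDegree = m) (hf₂0 : f₂ ≠ 0)
    (ha : a.natDegree ≤ n + m) (hc : c.natDegree ≤ n + m)
    (hb : b.natDegree ≤ n) (hd : d.natDegree ≤ n)
    (hinf : ∀ w : K, w ^ 2 = f₁.coeff m * f₂.coeff m → a.coeff (n + m) + w * b.coeff n = 0 →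
      c.coeff (n + m) + w * d.coeff n ≠ 0)
    (h₁ : (a * x + b * f₂ * y).degree < ↑(n + m)) (h₂ : (a * y + b * f₁ * x).degree < ↑(n + m))
    (h₃ : (c * x + d * f₂ * y).degree < ↑(n + m)) (h₄ : (c * y + d * f₁ * x).degree < ↑(n + m)) :
    x = 0 ∧ y = 0 := by
  by_contra hne
  let N := max x.natDegree y.natDegree
  have key : ∀ p q g u v : K[X], p.natDegree ≤ n + m → q.natDegree ≤ n → g.natDegree = m →
      u.natDegree ≤ N → v.natDegree ≤ N → (p * u + q * g * v).degree < ↑(n + m) →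
      p.coeff (n + m) * u.coeff N + q.coeff n * g.coeff m * v.coeff N = 0 := by
    intro p q g u v hp hq hg hu hv h
    have := coeff_eq_zero_of_degree_lt
      (h.trans_le (by exact_mod_cast Nat.le_add_right (n + m) N : (↑(n + m) : WithBot ℕ) ≤ ↑(n + m + N)))
    rw [coeff_add, coeff_mul_add_eq_of_natDegree_le hp hu, coeff_mul_add_eq_of_natDegree_le
      (natDegree_mul_le.trans (add_le_add hq hg.le)) hv,
      coeff_mul_add_eq_of_natDegree_le hq hg.le] at this
    exact this
  have hx : x.natDegree ≤ N := le_max_left _ _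
  have hy : y.natDegree ≤ N := le_max_right _ _
  have hxy : x.coeff N ≠ 0 ∨ y.coeff N ≠ 0 := by
    by_contra! h
    rcases le_total y.natDegree x.natDegree with hle | hle
    · have hN : N = x.natDegree := max_eq_left hle
      rw [hN] at h
      have hx0 : x = 0 := leadingCoeff_eq_zero.mp h.1
      subst hx0
      rw [natDegree_zero, Nat.le_zero] at hle
      rw [natDegree_zero, ← hle] at h
      exact hne ⟨rfl, leadingCoeff_eq_zero.mp h.2⟩
    · have hN : N = y.natDegree := max_eq_right hle
      rw [hN] at h
      have hy0 : y = 0 := leadingCoeff_eq_zero.mp h.2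
      subst hy0
      rw [natDegree_zero, Nat.le_zero] at hle
      rw [natDegree_zero, ← hle] at h
      exact hne ⟨leadingCoeff_eq_zero.mp h.1, rfl⟩
  have hl₂ : f₂.coeff m ≠ 0 := by rw [← hf₂]; exact leadingCoeff_ne_zero.mpr hf₂0
  obtain ⟨w, hw, hw₁, hw₂⟩ := exists_sq_eq_of_common_kernel hl₂ hxy
    (key a b f₂ x y ha hb hf₂ hx hy h₁) (key a b f₁ y x ha hb hf₁ hy hx h₂)
    (key c d f₂ x y hc hd hf₂ hx hy h₃) (key c d f₁ y x hc hd hf₁ hy hx h₄)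
  exact hinf w hw hw₁ hw₂

theorem coeff_iterate_divX {R : Type*} [Semiring R] (n : ℕ) (p : R[X]) (i : ℕ) :
    (divX^[n] p).coeff i = p.coeff (i + n) := by
  induction n generalizing p with
  | zero => rfl
  | succ n ih => rw [Function.iterate_succ_apply, ih, coeff_divX, add_assoc]

theorem degree_iterate_divX_lt {R : Type*} [Semiring R] {m n : ℕ} {p : R[X]}
    (h : p.degree < ↑(m + n)) : (divX^[n] p).degree < m := by
  rw [degree_lt_iff_coeff_zero] at h ⊢
  intro i hi
  rw [coeff_iterate_divX]
  exact h _ (by omega)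

theorem degree_lt_of_iterate_divX_eq_zero {R : Type*} [Semiring R] {n : ℕ} {p : R[X]}
    (h : divX^[n] p = 0) : p.degree < n := by
  rw [degree_lt_iff_coeff_zero]
  intro i hi
  rw [← Nat.sub_add_cancel hi, ← coeff_iterate_divX, h, coeff_zero]

theorem iterate_divX_eq_zero {R : Type*} [Semiring R] {n : ℕ} {p : R[X]}
    (h : p.degree < n) : divX^[n] p = 0 := by
  ext i
  rw [coeff_iterate_divX, coeff_zero]
  exact coeff_eq_zero_of_degree_lt (h.trans_le (by exact_mod_cast Nat.le_add_left _ _))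

/-- If `a + b√f` and `c + d√f` have no common zero, then they are not annihilated by any
nonzero pair in the sense of the Bézout construction. -/
theorem eq_zero_of_bezout_eq_zero {K : Type*} [Field K] [IsAlgClosed K]
    {m n : ℕ} {f₁ f₂ a b c d x y : K[X]}
    (hf₁ : f₁.natDegree = m) (hf₂ : f₂.natDegree = m) (hf₂0 : f₂ ≠ 0)
    (ha : a.natDegree ≤ n + m) (hc : c.natDegree ≤ n + m)
    (hb : b.natDegree ≤ n) (hd : d.natDegree ≤ n)
    (haff : ∀ t s : K, s ^ 2 = (f₁ * f₂).eval t → a.eval t + b.eval t * s = 0 →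
      c.eval t + d.eval t * s ≠ 0)
    (hinf : ∀ w : K, w ^ 2 = f₁.coeff m * f₂.coeff m → a.coeff (n + m) + w * b.coeff n = 0 →
      c.coeff (n + m) + w * d.coeff n ≠ 0)
    (hx : x.degree < ↑(n + m)) (hy : y.degree < ↑(n + m))
    (h₁ : a * divX^[n + m] (c * x + d * f₂ * y) + b * f₂ * divX^[n + m] (c * y + d * f₁ * x) =
      c * divX^[n + m] (a * x + b * f₂ * y) + d * f₂ * divX^[n + m] (a * y + b * f₁ * x))
    (h₂ : a * divX^[n + m] (c * y + d * f₁ * x) + b * f₁ * divX^[n + m] (c * x + d * f₂ * y) =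
      c * divX^[n + m] (a * y + b * f₁ * x) + d * f₁ * divX^[n + m] (a * x + b * f₂ * y)) :
    x = 0 ∧ y = 0 := by
  have hdeg : ∀ p q g u v : K[X], p.natDegree ≤ n + m → q.natDegree ≤ n → g.natDegree = m →
      u.degree < ↑(n + m) → v.degree < ↑(n + m) →
      (divX^[n + m] (p * u + q * g * v)).degree < ↑(n + m) := by
    intro p q g u v hp hq hg hu hv
    have mul_lt : ∀ r z : K[X], r.natDegree ≤ n + m → z.degree < ↑(n + m) →
        (r * z).degree < ↑(n + m + (n + m)) := by
      intro r z hr hz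
      rw [degree_lt_iff_coeff_zero]
      intro i hi
      rw [coeff_mul]
      refine Finset.sum_eq_zero fun ij hij => ?_
      replace hij := Finset.HasAntidiagonal.mem_antidiagonal.mp hij
      rcases lt_or_ge (n + m) ij.1 with h | h
      · rw [coeff_eq_zero_of_natDegree_lt (hr.trans_lt h), zero_mul]
      · rw [(degree_lt_iff_coeff_zero _ _).mp hz ij.2 (by omega), mul_zero]
    exact degree_iterate_divX_lt ((degree_add_le _ _).trans_lt (max_lt (mul_lt _ _ hp hu)
      (mul_lt _ _ (natDegree_mul_le.trans (add_le_add hq hg.le)) hv)))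
  have hA₁ := hdeg a b f₂ x y ha hb hf₂ hx hy
  have hA₂ := hdeg a b f₁ y x ha hb hf₁ hy hx
  have hC₁ := hdeg c d f₂ x y hc hd hf₂ hx hy
  have hC₂ := hdeg c d f₁ y x hc hd hf₁ hy hx
  have hvan : ∀ {u v : K[X]}, (a * u + b * f₂ * v).degree < ↑(n + m) →
      (a * v + b * f₁ * u).degree < ↑(n + m) → (c * u + d * f₂ * v).degree < ↑(n + m) →
      (c * v + d * f₁ * u).degree < ↑(n + m) → u = 0 ∧ v = 0 :=
    eq_zero_of_degree_mul_lt hf₁ hf₂ hf₂0 ha hc hb hd hinf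
  obtain ⟨u₀, u₁, v₀, v₁, huv₁, huv₂⟩ := exists_cofactors_of_no_common_zero haff
  generalize hPA : divX^[n + m] (a * x + b * f₂ * y) = A₁ at *
  generalize hQA : divX^[n + m] (a * y + b * f₁ * x) = A₂ at *
  generalize hPC : divX^[n + m] (c * x + d * f₂ * y) = C₁ at *
  generalize hQC : divX^[n + m] (c * y + d * f₁ * x) = C₂ at *
  let z₁ := u₀ * A₁ + u₁ * f₂ * A₂ + v₀ * C₁ + v₁ * f₂ * C₂
  let z₂ := u₀ * A₂ + u₁ * f₁ * A₁ + v₀ * C₂ + v₁ * f₁ * C₁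
  have ezA₁ : a * z₁ + b * f₂ * z₂ = A₁ := by
    linear_combination v₀ * h₁ + v₁ * f₂ * h₂ + A₁ * huv₁ + f₂ * A₂ * huv₂
  have ezA₂ : a * z₂ + b * f₁ * z₁ = A₂ := by
    linear_combination v₀ * h₂ + v₁ * f₁ * h₁ + A₂ * huv₁ + f₁ * A₁ * huv₂
  have ezC₁ : c * z₁ + d * f₂ * z₂ = C₁ := by
    linear_combination -u₀ * h₁ - u₁ * f₂ * h₂ + C₁ * huv₁ + f₂ * C₂ * huv₂
  have ezC₂ : c * z₂ + d * f₁ * z₁ = C₂ := by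
    linear_combination -u₀ * h₂ - u₁ * f₁ * h₁ + C₂ * huv₁ + f₁ * C₁ * huv₂
  obtain ⟨hz₁, hz₂⟩ := hvan (ezA₁ ▸ hA₁) (ezA₂ ▸ hA₂) (ezC₁ ▸ hC₁) (ezC₂ ▸ hC₂)
  simp only [hz₁, hz₂, mul_zero, add_zero] at ezA₁ ezA₂ ezC₁ ezC₂
  exact hvan (degree_lt_of_iterate_divX_eq_zero (hPA.trans ezA₁.symm))
    (degree_lt_of_iterate_divX_eq_zero (hQA.trans ezA₂.symm))
    (degree_lt_of_iterate_divX_eq_zero (hPC.trans ezC₁.symm))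
    (degree_lt_of_iterate_divX_eq_zero (hQC.trans ezC₂.symm))

theorem coeff_mul_iterate_divX {R : Type*} [Semiring R] (u v : R[X]) (i j : ℕ) :
    (u * divX^[j + 1] v).coeff i =
      ∑ p ∈ Finset.range (i + 1), u.coeff p * v.coeff (i + j + 1 - p) := by
  rw [coeff_mul, Finset.Nat.sum_antidiagonal_eq_sum_range_succ
    (fun p q => u.coeff p * (divX^[j + 1] v).coeff q)]
  refine Finset.sum_congr rfl fun p hp => ?_
  rw [Finset.mem_range] at hp
  rw [coeff_iterate_divX]
  congr 2
  omega

theorem coeff_mul_iterate_divX_add {R : Type*} [CommSemiring R] (u v : R[X]) (i j : ℕ) :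
    (u * divX^[j + 1] v).coeff i + (v * divX^[i + 1] u).coeff j = (u * v).coeff (i + j + 1) := by
  rw [coeff_mul_iterate_divX, coeff_mul_iterate_divX, coeff_mul,
    Finset.Nat.sum_antidiagonal_eq_sum_range_succ (fun p q => u.coeff p * v.coeff q),
    show (i + j + 1).succ = (i + 1) + (j + 1) by omega, Finset.sum_range_add _ (i + 1)]
  congr 1
  rw [← Finset.sum_range_reflect]
  refine Finset.sum_congr rfl fun p hp => ?_
  rw [Finset.mem_range] at hp
  rw [mul_comm]
  congr 2 <;> omega

theorem sum_range_range_ite {M : Type*} [AddCommMonoid M] {k m N : ℕ} (hm : m ≤ k) (hmN : m ≤ N)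
    (C : ℕ → ℕ → Prop) [∀ p q, Decidable (C p q)] (hC : ∀ p q, C p q ↔ p ≤ m ∧ p + q = N)
    (Φ : ℕ → ℕ → M) (hΦ : ∀ p q, k < q → Φ p q = 0) :
    (∑ p ∈ Finset.range (k + 1), ∑ q ∈ Finset.range (k + 1), if C p q then Φ p q else 0) =
      ∑ p ∈ Finset.range (m + 1), Φ p (N - p) := by
  rw [← Finset.sum_subset (Finset.range_mono (Nat.succ_le_succ hm))]
  · refine Finset.sum_congr rfl fun p hp => ?_
    rw [Finset.mem_range] at hp
    rw [Finset.sum_eq_single (N - p)]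
    · rw [if_pos ((hC _ _).mpr (by omega))]
    · intro q _ hq
      rw [if_neg fun h => hq (by have := (hC _ _).mp h; omega)]
    · intro hq
      rw [Finset.mem_range] at hq
      rw [hΦ _ _ (by omega), ite_self]
  · intro p _ hp
    rw [Finset.mem_range] at hp
    exact Finset.sum_eq_zero fun q _ => if_neg fun h => hp (by have := (hC _ _).mp h; omega)

theorem sum_minor_eq_coeff {R : Type*} [CommRing R] {k : ℕ} {u v : R[X]}
    (hu : u.natDegree ≤ k) (hv : v.natDegree ≤ k) {i j : ℕ} (hj : j < k) :
    (∑ p ∈ Finset.range (k + 1), ∑ q ∈ Finset.range (k + 1),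
      if p < q ∧ p ≤ min i j ∧ p + q = i + j + 1 then
        u.coeff p * v.coeff q - v.coeff p * u.coeff q else 0) =
      (u * divX^[j + 1] v - v * divX^[j + 1] u).coeff i := by
  rw [sum_range_range_ite (m := min i j) (N := i + j + 1) (by omega) (by omega) _
    (fun p q => by omega) (fun p q => u.coeff p * v.coeff q - v.coeff p * u.coeff q)]
  · have h : ∀ i' j', (u * divX^[j' + 1] v - v * divX^[j' + 1] u).coeff i' =
        ∑ p ∈ Finset.range (i' + 1), (u.coeff p * v.coeff (i' + j' + 1 - p) -
          v.coeff p * u.coeff (i' + j' + 1 - p)) := by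
      intro i' j'
      rw [coeff_sub, coeff_mul_iterate_divX, coeff_mul_iterate_divX, Finset.sum_sub_distrib]
    rcases le_total i j with hij | hij
    · rw [min_eq_left hij, h]
    · rw [min_eq_right hij]
      have huv := coeff_mul_iterate_divX_add u v i j
      have hvu := coeff_mul_iterate_divX_add v u i j
      rw [mul_comm v u, ← huv] at hvu
      have := h j i
      rw [add_comm j i] at this
      rw [← this, coeff_sub, coeff_sub]
      linear_combination hvu
  · intro p q hq
    rw [coeff_eq_zero_of_natDegree_lt (hu.trans_lt hq),
      coeff_eq_zero_of_natDegree_lt (hv.trans_lt hq), mul_zero, mul_zero, sub_zero]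

theorem sum_mixed_minor_eq_coeff {R : Type*} [CommRing R] {k : ℕ} {u v u' v' : R[X]}
    (hv' : v'.natDegree ≤ k) (hv : v.natDegree ≤ k) (huv : u * v' = u' * v)
    {i j : ℕ} (hj : j < k) :
    (∑ p ∈ Finset.range (k + 1), ∑ q ∈ Finset.range (k + 1),
      if p ≤ j ∧ p + q = i + j + 1 then
        u.coeff p * v'.coeff q - u'.coeff p * v.coeff q else 0) =
      (v * divX^[j + 1] u' - v' * divX^[j + 1] u).coeff i := by
  rw [sum_range_range_ite (m := j) (N := i + j + 1) (by omega) (by omega) _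
    (fun p q => by omega) (fun p q => u.coeff p * v'.coeff q - u'.coeff p * v.coeff q)]
  · rw [Finset.sum_sub_distrib, add_comm i j, ← coeff_mul_iterate_divX, ← coeff_mul_iterate_divX,
      coeff_sub]
    have h₁ := coeff_mul_iterate_divX_add u v' j i
    have h₂ := coeff_mul_iterate_divX_add u' v j i
    rw [huv] at h₁
    linear_combination h₁ - h₂
  · intro p q hq
    rw [coeff_eq_zero_of_natDegree_lt (hv.trans_lt hq),
      coeff_eq_zero_of_natDegree_lt (hv'.trans_lt hq), mul_zero, mul_zero, sub_zero]

section

variable {K : Type*} [CommRing K] (k : ℕ) (r s f1 f2 : K[X])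

theorem heRow_fst {p : ℕ} (hp : p < k + 1) : heRow k r s f1 f2 p = r.coeff p := by
  rw [heRow, if_pos hp]

theorem heRow_snd {p : ℕ} (hp : p < k + 1) :
    heRow k r s f1 f2 (p + (k + 1)) = (s * f1).coeff p := by
  rw [heRow, if_neg (by omega), if_pos (by omega), Nat.add_sub_cancel]

theorem heRow_trd (p : ℕ) :
    heRow k r s f1 f2 (p + 2 * (k + 1)) = (s * f2).coeff p := by
  rw [heRow, if_neg (by omega), if_neg (by omega), Nat.add_sub_cancel]

end

section

variable {K : Type*} [CommRing K] {k : ℕ} {a b c d f1 f2 : K[X]}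

theorem heA11_eq_coeff (ha : a.natDegree ≤ k) (hc : c.natDegree ≤ k)
    (hb : (b * f2).natDegree ≤ k) (hd : (d * f2).natDegree ≤ k) {i j : ℕ} (hj : j < k) :
    heA11 k a b c d f1 f2 i j =
      (b * f2 * divX^[j + 1] c - c * divX^[j + 1] (b * f2) +
        (a * divX^[j + 1] (d * f2) - d * f2 * divX^[j + 1] a)).coeff i := by
  rw [coeff_add, ← sum_minor_eq_coeff hb hc hj, ← sum_minor_eq_coeff ha hd hj,
    ← Finset.sum_add_distrib, heA11]
  refine Finset.sum_congr rfl fun p hp => ?_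
  rw [← Finset.sum_add_distrib]
  refine Finset.sum_congr rfl fun q hq => ?_
  rw [Finset.mem_range] at hp hq
  split_ifs
  · simp only [heMinor, heRow_fst _ _ _ _ _ hp, heRow_fst _ _ _ _ _ hq, heRow_trd]
    ring
  · rw [add_zero]

theorem heA22_eq_coeff (ha : a.natDegree ≤ k) (hc : c.natDegree ≤ k)
    (hb : (b * f1).natDegree ≤ k) (hd : (d * f1).natDegree ≤ k) {i j : ℕ} (hj : j < k) :
    heA22 k a b c d f1 f2 i j =
      (b * f1 * divX^[j + 1] c - c * divX^[j + 1] (b * f1) +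
        (a * divX^[j + 1] (d * f1) - d * f1 * divX^[j + 1] a)).coeff i := by
  rw [coeff_add, ← sum_minor_eq_coeff hb hc hj, ← sum_minor_eq_coeff ha hd hj,
    ← Finset.sum_add_distrib, heA22]
  refine Finset.sum_congr rfl fun p hp => ?_
  rw [← Finset.sum_add_distrib]
  refine Finset.sum_congr rfl fun q hq => ?_
  rw [Finset.mem_range] at hp hq
  split_ifs
  · simp only [heMinor, heRow_fst _ _ _ _ _ hp, heRow_fst _ _ _ _ _ hq, heRow_snd _ _ _ _ _ hp,
      heRow_snd _ _ _ _ _ hq]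
    ring
  · rw [add_zero]

theorem heA12_eq_coeff (ha : a.natDegree ≤ k) (hc : c.natDegree ≤ k)
    (hb : (b * f2).natDegree ≤ k) (hd : (d * f2).natDegree ≤ k) {i j : ℕ} (hj : j < k) :
    heA12 k a b c d f1 f2 i j =
      (a * divX^[j + 1] c - c * divX^[j + 1] a +
        (b * f2 * divX^[j + 1] (d * f1) - d * f2 * divX^[j + 1] (b * f1))).coeff i := by
  rw [coeff_add, ← sum_minor_eq_coeff ha hc hj, ← sum_mixed_minor_eq_coeff hd hb (by ring) hj,
    heA12]
  congr 1 <;>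
  · refine Finset.sum_congr rfl fun p hp => Finset.sum_congr rfl fun q hq => ?_
    rw [Finset.mem_range] at hp hq
    simp only [heMinor, heRow_fst _ _ _ _ _ hp, heRow_fst _ _ _ _ _ hq, heRow_snd _ _ _ _ _ hp,
      heRow_trd]
    congr 1
    ring

theorem heA21_eq_coeff (ha : a.natDegree ≤ k) (hc : c.natDegree ≤ k)
    (hb : (b * f1).natDegree ≤ k) (hd : (d * f1).natDegree ≤ k) {i j : ℕ} (hj : j < k) :
    heA21 k a b c d f1 f2 i j =
      (a * divX^[j + 1] c - c * divX^[j + 1] a +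
        (b * f1 * divX^[j + 1] (d * f2) - d * f1 * divX^[j + 1] (b * f2))).coeff i := by
  rw [coeff_add, ← sum_minor_eq_coeff ha hc hj, ← sum_mixed_minor_eq_coeff hd hb (by ring) hj,
    heA21]
  congr 1 <;>
  · refine Finset.sum_congr rfl fun p hp => Finset.sum_congr rfl fun q hq => ?_
    rw [Finset.mem_range] at hp hq
    simp only [heMinor, heRow_fst _ _ _ _ _ hp, heRow_fst _ _ _ _ _ hq, heRow_snd _ _ _ _ _ hq,
      heRow_trd]
    congr 1
    ring

theorem sum_range_range_ite_eq_zero {M : Type*} [AddCommMonoid M] {m N : ℕ} (hN : m + k < N)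
    (C : ℕ → ℕ → Prop) [∀ p q, Decidable (C p q)] (hC : ∀ p q, C p q → p ≤ m ∧ p + q = N)
    (Φ : ℕ → ℕ → M) :
    (∑ p ∈ Finset.range (k + 1), ∑ q ∈ Finset.range (k + 1), if C p q then Φ p q else 0) = 0 :=
  Finset.sum_eq_zero fun p _ => Finset.sum_eq_zero fun q hq => if_neg fun h => by
    have := hC p q h
    rw [Finset.mem_range] at hq
    omega

theorem heA_eq_zero_of_le {i j : ℕ} (hi : k ≤ i) :
    heA11 k a b c d f1 f2 i j = 0 ∧ heA12 k a b c d f1 f2 i j = 0 ∧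
      heA21 k a b c d f1 f2 i j = 0 ∧ heA22 k a b c d f1 f2 i j = 0 := by
  have hN : j + k < i + j + 1 := by omega
  refine ⟨?_, ?_, ?_, ?_⟩
  · exact sum_range_range_ite_eq_zero hN _ (fun p q h => by omega) _
  · rw [heA12, sum_range_range_ite_eq_zero hN _ (fun p q h => by omega),
      sum_range_range_ite_eq_zero hN _ (fun p q h => h), add_zero]
  · rw [heA21, sum_range_range_ite_eq_zero hN _ (fun p q h => by omega),
      sum_range_range_ite_eq_zero hN _ (fun p q h => h), add_zero]
  · exact sum_range_range_ite_eq_zero hN _ (fun p q h => by omega) _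

theorem iterate_divX_mul_eq_sum (p : K[X]) {y : K[X]} (hy : y.degree < k) :
    divX^[k] (p * y) =
      ∑ j ∈ Finset.range k, C (y.coeff (k - 1 - j)) * divX^[j + 1] p := by
  ext i
  simp only [finsetSum_coeff, coeff_C_mul, coeff_iterate_divX]
  rw [mul_comm p y, coeff_mul, Finset.Nat.sum_antidiagonal_eq_sum_range_succ
    (fun e q => y.coeff e * p.coeff q),
    ← Finset.sum_subset (Finset.range_mono (show k ≤ (i + k).succ by omega)),
    ← Finset.sum_range_reflect]
  · refine Finset.sum_congr rfl fun e he => ?_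
    rw [Finset.mem_range] at he
    congr 2
    omega
  · intro e _ he
    rw [(degree_lt_iff_coeff_zero _ _).mp hy e (by simpa using he), zero_mul]

theorem iterate_divX_add (n : ℕ) (p q : K[X]) :
    divX^[n] (p + q) = divX^[n] p + divX^[n] q := by
  ext i
  simp only [coeff_iterate_divX, coeff_add]

theorem sum_heA1_mul_eq_coeff {x y : K[X]} (ha : a.natDegree ≤ k) (hc : c.natDegree ≤ k)
    (hb : (b * f2).natDegree ≤ k) (hd : (d * f2).natDegree ≤ k)
    (hx : x.degree < k) (hy : y.degree < k) (i : ℕ) :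
    (∑ j ∈ Finset.range k, heA11 k a b c d f1 f2 i j * y.coeff (k - 1 - j)) +
      ∑ j ∈ Finset.range k, heA12 k a b c d f1 f2 i j * x.coeff (k - 1 - j) =
    (a * divX^[k] (c * x + d * f2 * y) + b * f2 * divX^[k] (c * y + d * f1 * x) -
      (c * divX^[k] (a * x + b * f2 * y) + d * f2 * divX^[k] (a * y + b * f1 * x))).coeff i := by
  simp only [iterate_divX_add, iterate_divX_mul_eq_sum _ hx, iterate_divX_mul_eq_sum _ hy,
    ← Finset.sum_add_distrib, Finset.mul_sum, ← Finset.sum_sub_distrib]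
  rw [finsetSum_coeff]
  refine Finset.sum_congr rfl fun j hj => ?_
  rw [Finset.mem_range] at hj
  rw [heA11_eq_coeff ha hc hb hd hj, heA12_eq_coeff ha hc hb hd hj, ← coeff_mul_C, ← coeff_mul_C,
    ← coeff_add]
  congr 1
  ring

theorem sum_heA2_mul_eq_coeff {x y : K[X]} (ha : a.natDegree ≤ k) (hc : c.natDegree ≤ k)
    (hb : (b * f1).natDegree ≤ k) (hd : (d * f1).natDegree ≤ k)
    (hx : x.degree < k) (hy : y.degree < k) (i : ℕ) :
    (∑ j ∈ Finset.range k, heA21 k a b c d f1 f2 i j * y.coeff (k - 1 - j)) +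
      ∑ j ∈ Finset.range k, heA22 k a b c d f1 f2 i j * x.coeff (k - 1 - j) =
    (a * divX^[k] (c * y + d * f1 * x) + b * f1 * divX^[k] (c * x + d * f2 * y) -
      (c * divX^[k] (a * y + b * f1 * x) + d * f1 * divX^[k] (a * x + b * f2 * y))).coeff i := by
  simp only [iterate_divX_add, iterate_divX_mul_eq_sum _ hx, iterate_divX_mul_eq_sum _ hy,
    ← Finset.sum_add_distrib, Finset.mul_sum, ← Finset.sum_sub_distrib]
  rw [finsetSum_coeff]
  refine Finset.sum_congr rfl fun j hj => ?_
  rw [Finset.mem_range] at hj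
  rw [heA21_eq_coeff ha hc hb hd hj, heA22_eq_coeff ha hc hb hd hj, ← coeff_mul_C, ← coeff_mul_C,
    ← coeff_add]
  congr 1
  ring

theorem heBezoutMatrix_mulVec_eq_zero_iff (v : ℕ → K) :
    (heBezoutMatrix k a b c d f1 f2).mulVec (fun u => v u) = 0 ↔
      ∀ i, (∑ j ∈ Finset.range k, heA11 k a b c d f1 f2 i j * v j) +
          ∑ j ∈ Finset.range k, heA12 k a b c d f1 f2 i j * v (k + j) = 0 ∧
        (∑ j ∈ Finset.range k, heA21 k a b c d f1 f2 i j * v j) +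
          ∑ j ∈ Finset.range k, heA22 k a b c d f1 f2 i j * v (k + j) = 0 := by
  have key : ∀ (G H : ℕ → K), ∑ u : Fin (2 * k),
      (if u.val < k then G u.val else H (u.val - k)) * v u =
      (∑ j ∈ Finset.range k, G j * v j) + ∑ j ∈ Finset.range k, H j * v (k + j) := by
    intro G H
    rw [Fin.sum_univ_eq_sum_range (fun u => (if u < k then G u else H (u - k)) * v u) (2 * k),
      two_mul, Finset.sum_range_add]
    congr 1
    · refine Finset.sum_congr rfl fun j hj => ?_
      rw [if_pos (Finset.mem_range.mp hj)]
    · refine Finset.sum_congr rfl fun j _ => ?_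
      rw [if_neg (by omega), Nat.add_sub_cancel_left]
  constructor
  · intro h i
    rcases lt_or_ge i k with hi | hi
    · constructor
      · rw [← key, ← show _ = (0 : K) from congrFun h ⟨i, by omega⟩]
        simp [Matrix.mulVec, dotProduct, heBezoutMatrix, hi]
      · rw [← key, ← show _ = (0 : K) from congrFun h ⟨k + i, by omega⟩]
        simp [Matrix.mulVec, dotProduct, heBezoutMatrix]
    · simp [heA_eq_zero_of_le hi]
  · intro h
    funext u
    rcases lt_or_ge u.val k with hu | hu
    · rw [Pi.zero_apply, ← (h u.val).1, ← key]
      simp [Matrix.mulVec, dotProduct, heBezoutMatrix, hu]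
    · rw [Pi.zero_apply, ← (h (u.val - k)).2, ← key]
      simp [Matrix.mulVec, dotProduct, heBezoutMatrix, hu.not_gt]

end

theorem coeff_sum_C_mul_X_pow {K : Type*} [CommRing K] (k : ℕ) (v : ℕ → K) {j : ℕ} (hj : j < k) :
    (∑ e ∈ Finset.range k, C (v e) * X ^ (k - 1 - e) : K[X]).coeff (k - 1 - j) = v j := by
  simp only [finsetSum_coeff, coeff_C_mul, coeff_X_pow]
  rw [Finset.sum_eq_single j]
  · simp
  · intro e he hej
    rw [Finset.mem_range] at he
    rw [if_neg (by omega), mul_zero]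
  · simp [hj]

theorem degree_sum_C_mul_X_pow_lt {K : Type*} [CommRing K] (k : ℕ) (v : ℕ → K) :
    (∑ e ∈ Finset.range k, C (v e) * X ^ (k - 1 - e) : K[X]).degree < k := by
  rw [degree_lt_iff_coeff_zero]
  intro i hi
  simp only [finsetSum_coeff, coeff_C_mul, coeff_X_pow]
  refine Finset.sum_eq_zero fun e he => ?_
  rw [Finset.mem_range] at he
  rw [if_neg (by omega), mul_zero]

theorem det_heBezoutMatrix_eq_zero_iff {K : Type*} [Field K] {k : ℕ} {a b c d f1 f2 : K[X]}
    (ha : a.natDegree ≤ k) (hc : c.natDegree ≤ k)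
    (hb1 : (b * f1).natDegree ≤ k) (hd1 : (d * f1).natDegree ≤ k)
    (hb2 : (b * f2).natDegree ≤ k) (hd2 : (d * f2).natDegree ≤ k) :
    (heBezoutMatrix k a b c d f1 f2).det = 0 ↔
      ∃ x y : K[X], x.degree < k ∧ y.degree < k ∧ ¬(x = 0 ∧ y = 0) ∧
        a * divX^[k] (c * x + d * f2 * y) + b * f2 * divX^[k] (c * y + d * f1 * x) =
          c * divX^[k] (a * x + b * f2 * y) + d * f2 * divX^[k] (a * y + b * f1 * x) ∧
        a * divX^[k] (c * y + d * f1 * x) + b * f1 * divX^[k] (c * x + d * f2 * y) =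
          c * divX^[k] (a * y + b * f1 * x) + d * f1 * divX^[k] (a * x + b * f2 * y) := by
  have key : ∀ (v : ℕ → K) (x y : K[X]), x.degree < k → y.degree < k →
      (∀ j < k, y.coeff (k - 1 - j) = v j) → (∀ j < k, x.coeff (k - 1 - j) = v (k + j)) →
      ((heBezoutMatrix k a b c d f1 f2).mulVec (fun u => v u) = 0 ↔
        a * divX^[k] (c * x + d * f2 * y) + b * f2 * divX^[k] (c * y + d * f1 * x) =
          c * divX^[k] (a * x + b * f2 * y) + d * f2 * divX^[k] (a * y + b * f1 * x) ∧
        a * divX^[k] (c * y + d * f1 * x) + b * f1 * divX^[k] (c * x + d * f2 * y) =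
          c * divX^[k] (a * y + b * f1 * x) + d * f1 * divX^[k] (a * x + b * f2 * y)) := by
    intro v x y hx hy hyv hxv
    rw [heBezoutMatrix_mulVec_eq_zero_iff, forall_and, ← sub_eq_zero, Polynomial.ext_iff,
      ← sub_eq_zero (a := a * divX^[k] (c * y + d * f1 * x) + _), Polynomial.ext_iff]
    refine and_congr (forall_congr' fun i => ?_) (forall_congr' fun i => ?_)
    · rw [← sum_heA1_mul_eq_coeff ha hc hb2 hd2 hx hy, coeff_zero,
        Finset.sum_congr rfl fun j hj => by rw [← hyv j (Finset.mem_range.mp hj)],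
        Finset.sum_congr (s₁ := Finset.range k) (f := fun j => _ * v (k + j)) rfl
          fun j hj => by rw [← hxv j (Finset.mem_range.mp hj)]]
    · rw [← sum_heA2_mul_eq_coeff ha hc hb1 hd1 hx hy, coeff_zero,
        Finset.sum_congr rfl fun j hj => by rw [← hyv j (Finset.mem_range.mp hj)],
        Finset.sum_congr (s₁ := Finset.range k) (f := fun j => _ * v (k + j)) rfl
          fun j hj => by rw [← hxv j (Finset.mem_range.mp hj)]]
  rw [← Matrix.exists_mulVec_eq_zero_iff]
  constructor
  · rintro ⟨w, hw0, hw⟩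
    let v : ℕ → K := fun u => if h : u < 2 * k then w ⟨u, h⟩ else 0
    have hv : (fun u : Fin (2 * k) => v u) = w := by
      funext u
      simp [v]
    have hy := fun j hj => coeff_sum_C_mul_X_pow k v (j := j) hj
    have hx := fun j hj => coeff_sum_C_mul_X_pow k (fun j => v (k + j)) (j := j) hj
    refine ⟨_, _, degree_sum_C_mul_X_pow_lt k _, degree_sum_C_mul_X_pow_lt k _, ?_,
      (key v _ _ (degree_sum_C_mul_X_pow_lt k _) (degree_sum_C_mul_X_pow_lt k _) hy hx).mp
        (hv.symm ▸ hw)⟩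
    rintro ⟨hx0, hy0⟩
    refine hw0 (hv ▸ funext fun u => ?_)
    rcases lt_or_ge u.val k with hu | hu
    · simpa [hy0] using (hy u hu).symm
    · have := hx (u - k) (by omega)
      rw [hx0, coeff_zero, Nat.add_sub_cancel' hu] at this
      exact this.symm
  · rintro ⟨x, y, hx, hy, hxy, h⟩
    let v : ℕ → K := fun u => if u < k then y.coeff (k - 1 - u) else x.coeff (k - 1 - (u - k))
    have hyv : ∀ j < k, y.coeff (k - 1 - j) = v j := fun j hj => by simp [v, hj]
    have hxv : ∀ j < k, x.coeff (k - 1 - j) = v (k + j) := fun j hj => by simp [v]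
    refine ⟨fun u => v u, fun h0 => hxy ⟨?_, ?_⟩, (key v x y hx hy hyv hxv).mpr h⟩
    · ext i
      rcases lt_or_ge i k with hi | hi
      · have := hxv (k - 1 - i) (by omega)
        rw [show k - 1 - (k - 1 - i) = i by omega] at this
        exact this.trans (congrFun h0 ⟨k + (k - 1 - i), by omega⟩)
      · exact (degree_lt_iff_coeff_zero _ _).mp hx i hi
    · ext i
      rcases lt_or_ge i k with hi | hi
      · have := hyv (k - 1 - i) (by omega)
        rw [show k - 1 - (k - 1 - i) = i by omega] at this
        exact this.trans (congrFun h0 ⟨k - 1 - i, by omega⟩)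
      · exact (degree_lt_iff_coeff_zero _ _).mp hy i hi

theorem exists_sq_roots_mul_eq {K : Type*} [Field K] [IsAlgClosed K] {α β s : K}
    (hs : s ^ 2 = α * β) :
    ∃ ρ₁ ρ₂ : K, ρ₁ ^ 2 = α ∧ ρ₂ ^ 2 = β ∧ ρ₁ * ρ₂ = s := by
  obtain ⟨ρ₁, h₁⟩ := IsAlgClosed.exists_pow_nat_eq α (n := 2) (by norm_num)
  obtain ⟨ρ₂, h₂⟩ := IsAlgClosed.exists_pow_nat_eq β (n := 2) (by norm_num)
  have : (ρ₁ * ρ₂) ^ 2 = s ^ 2 := by rw [mul_pow, h₁, h₂, hs]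
  rcases sq_eq_sq_iff_eq_or_eq_neg.mp this with h | h
  · exact ⟨ρ₁, ρ₂, h₁, h₂, h⟩
  · exact ⟨ρ₁, -ρ₂, h₁, by rw [neg_sq, h₂], by rw [mul_neg, h, neg_neg]⟩

theorem exists_bezout_kernel_of_affine_zero {K : Type*} [Field K] [IsAlgClosed K]
    {k : ℕ} {f₁ f₂ a b c d : K[X]} {t s : K} (hk : 0 < k)
    (ha : a.natDegree ≤ k) (hc : c.natDegree ≤ k)
    (hb₁ : (b * f₁).natDegree ≤ k) (hd₁ : (d * f₁).natDegree ≤ k)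
    (hb₂ : (b * f₂).natDegree ≤ k) (hd₂ : (d * f₂).natDegree ≤ k)
    (hne : f₁.eval t ≠ 0 ∨ f₂.eval t ≠ 0) (hs : s ^ 2 = (f₁ * f₂).eval t)
    (hF : a.eval t + b.eval t * s = 0) (hH : c.eval t + d.eval t * s = 0) :
    ∃ x y : K[X], x.degree < k ∧ y.degree < k ∧ ¬(x = 0 ∧ y = 0) ∧
      a * divX^[k] (c * x + d * f₂ * y) + b * f₂ * divX^[k] (c * y + d * f₁ * x) =
        c * divX^[k] (a * x + b * f₂ * y) + d * f₂ * divX^[k] (a * y + b * f₁ * x) ∧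
      a * divX^[k] (c * y + d * f₁ * x) + b * f₁ * divX^[k] (c * x + d * f₂ * y) =
        c * divX^[k] (a * y + b * f₁ * x) + d * f₁ * divX^[k] (a * x + b * f₂ * y) := by
  obtain ⟨ρ₁, ρ₂, h₁, h₂, h₁₂⟩ := exists_sq_roots_mul_eq (s := s) (by rw [hs, eval_mul])
  obtain ⟨q, hq0, hq, hqdeg⟩ : ∃ q : K[X], q ≠ 0 ∧ (X - C t) * q = X ^ k - C (t ^ k) ∧
      q.natDegree + 1 = k := by
    have hroot : (X ^ k - C (t ^ k) : K[X]).IsRoot t := by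
      rw [IsRoot.def, eval_sub, eval_pow, eval_X, eval_C, sub_self]
    obtain ⟨q, hq⟩ := dvd_iff_isRoot.mpr hroot
    have hdeg := congrArg natDegree hq
    have hq0 : q ≠ 0 := by
      rintro rfl
      exact X_pow_sub_C_ne_zero hk (t ^ k) (by rw [hq, mul_zero])
    refine ⟨q, hq0, hq.symm, ?_⟩
    rw [natDegree_X_pow_sub_C, natDegree_mul (X_sub_C_ne_zero t) hq0, natDegree_X_sub_C] at hdeg
    omega
  have hlt : ∀ r : K, (C r * q).degree < k := fun r => by
    refine degree_le_natDegree.trans_lt ?_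
    exact_mod_cast (natDegree_C_mul_le r q).trans_lt (by omega : q.natDegree < k)
  -- a polynomial of degree at most `k` vanishing at `t` has a quotient computed by truncation
  have hquot : ∀ p : K[X], p.natDegree ≤ k → p.eval t = 0 →
      (X - C t) * divX^[k] (p * q) = p := by
    intro p hp hpt
    obtain ⟨r, rfl⟩ := dvd_iff_isRoot.mpr hpt
    have hr : r.degree < k := by
      by_cases hr0 : r = 0
      · rw [hr0, degree_zero]
        exact WithBot.bot_lt_coe k
      · rw [natDegree_mul (X_sub_C_ne_zero t) hr0, natDegree_X_sub_C] at hp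
        exact degree_le_natDegree.trans_lt (by exact_mod_cast (by omega : r.natDegree < k))
    rw [mul_right_comm, hq]
    congr 1
    ext i
    rw [coeff_iterate_divX, sub_mul, coeff_sub, mul_comm, coeff_mul_X_pow, coeff_C_mul,
      (degree_lt_iff_coeff_zero _ _).mp hr _ (Nat.le_add_left k i), mul_zero, sub_zero]
  have hcomb : ∀ (p g : K[X]) (α β : K), p.natDegree ≤ k → g.natDegree ≤ k →
      p.eval t * α + g.eval t * β = 0 →
      (X - C t) * divX^[k] (p * (C α * q) + g * (C β * q)) = p * C α + g * C β := by
    intro p g α β hp hg h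
    rw [← hquot (p * C α + g * C β)
      (natDegree_add_le_of_degree_le ((natDegree_mul_C_le _ _).trans hp)
        ((natDegree_mul_C_le _ _).trans hg)) (by simpa using h)]
    congr 2
    ring
  refine ⟨C ρ₂ * q, C ρ₁ * q, hlt _, hlt _, ?_, ?_, ?_⟩
  · rintro ⟨h, h'⟩
    rw [mul_eq_zero, C_eq_zero, or_iff_left hq0] at h h'
    rw [h] at h₂
    rw [h'] at h₁
    rcases hne with hne | hne
    · exact hne (by rw [← h₁]; ring)
    · exact hne (by rw [← h₂]; ring)
  all_goals
    have eC₁ := hcomb c (d * f₂) ρ₂ ρ₁ hc hd₂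
      (by rw [eval_mul]; linear_combination ρ₂ * hH - d.eval t * ρ₁ * h₂ + d.eval t * ρ₂ * h₁₂)
    have eC₂ := hcomb c (d * f₁) ρ₁ ρ₂ hc hd₁
      (by rw [eval_mul]; linear_combination ρ₁ * hH - d.eval t * ρ₂ * h₁ + d.eval t * ρ₁ * h₁₂)
    have eA₁ := hcomb a (b * f₂) ρ₂ ρ₁ ha hb₂
      (by rw [eval_mul]; linear_combination ρ₂ * hF - b.eval t * ρ₁ * h₂ + b.eval t * ρ₂ * h₁₂)
    have eA₂ := hcomb a (b * f₁) ρ₁ ρ₂ ha hb₁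
      (by rw [eval_mul]; linear_combination ρ₁ * hF - b.eval t * ρ₂ * h₁ + b.eval t * ρ₁ * h₁₂)
    refine mul_left_cancel₀ (X_sub_C_ne_zero t) ?_
  · linear_combination a * eC₁ + b * f₂ * eC₂ - c * eA₁ - d * f₂ * eA₂
  · linear_combination a * eC₂ + b * f₁ * eC₁ - c * eA₂ - d * f₁ * eA₁

theorem exists_bezout_kernel_of_zero_at_infinity {K : Type*} [Field K] [IsAlgClosed K]
    {m n : ℕ} {f₁ f₂ a b c d : K[X]} {w : K} (hk : 0 < n + m)
    (hf₁ : f₁.natDegree = m) (hf₂ : f₂.natDegree = m) (hf₂0 : f₂ ≠ 0)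
    (ha : a.natDegree ≤ n + m) (hc : c.natDegree ≤ n + m)
    (hb : b.natDegree ≤ n) (hd : d.natDegree ≤ n)
    (hw : w ^ 2 = f₁.coeff m * f₂.coeff m)
    (hF : a.coeff (n + m) + w * b.coeff n = 0) (hH : c.coeff (n + m) + w * d.coeff n = 0) :
    ∃ x y : K[X], x.degree < ↑(n + m) ∧ y.degree < ↑(n + m) ∧ ¬(x = 0 ∧ y = 0) ∧
      a * divX^[n + m] (c * x + d * f₂ * y) + b * f₂ * divX^[n + m] (c * y + d * f₁ * x) =
        c * divX^[n + m] (a * x + b * f₂ * y) + d * f₂ * divX^[n + m] (a * y + b * f₁ * x) ∧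
      a * divX^[n + m] (c * y + d * f₁ * x) + b * f₁ * divX^[n + m] (c * x + d * f₂ * y) =
        c * divX^[n + m] (a * y + b * f₁ * x) + d * f₁ * divX^[n + m] (a * x + b * f₂ * y) := by
  obtain ⟨ρ₁, ρ₂, h₁, h₂, h₁₂⟩ := exists_sq_roots_mul_eq hw
  have hvan : ∀ (p q g : K[X]) (α β : K), p.natDegree ≤ n + m → q.natDegree ≤ n →
      g.natDegree = m → p.coeff (n + m) * α + q.coeff n * g.coeff m * β = 0 →
      divX^[n + m] (p * C α + q * g * C β) = 0 := by
    intro p q g α β hp hq hg h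
    have hqg : (q * g).natDegree ≤ n + m := natDegree_mul_le.trans (add_le_add hq hg.le)
    refine iterate_divX_eq_zero ((degree_lt_iff_coeff_zero _ _).mpr fun i hi => ?_)
    rw [coeff_add, coeff_mul_C, coeff_mul_C]
    rcases hi.eq_or_lt with rfl | hi
    · rw [coeff_mul_add_eq_of_natDegree_le hq hg.le, h]
    · rw [coeff_eq_zero_of_natDegree_lt (hp.trans_lt hi),
        coeff_eq_zero_of_natDegree_lt (hqg.trans_lt hi), zero_mul, zero_mul, add_zero]
  have hlt : ∀ r : K, (C r).degree < ↑(n + m) := fun r =>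
    degree_C_le.trans_lt (by exact_mod_cast hk)
  have eC₁ := hvan c d f₂ ρ₂ ρ₁ hc hd hf₂
    (by linear_combination ρ₂ * hH - d.coeff n * ρ₁ * h₂ + d.coeff n * ρ₂ * h₁₂)
  have eC₂ := hvan c d f₁ ρ₁ ρ₂ hc hd hf₁
    (by linear_combination ρ₁ * hH - d.coeff n * ρ₂ * h₁ + d.coeff n * ρ₁ * h₁₂)
  have eA₁ := hvan a b f₂ ρ₂ ρ₁ ha hb hf₂
    (by linear_combination ρ₂ * hF - b.coeff n * ρ₁ * h₂ + b.coeff n * ρ₂ * h₁₂)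
  have eA₂ := hvan a b f₁ ρ₁ ρ₂ ha hb hf₁
    (by linear_combination ρ₁ * hF - b.coeff n * ρ₂ * h₁ + b.coeff n * ρ₁ * h₁₂)
  refine ⟨C ρ₂, C ρ₁, hlt _, hlt _, ?_, ?_, ?_⟩
  · rintro ⟨h, -⟩
    rw [C_eq_zero.mp h, zero_pow two_ne_zero, ← hf₂] at h₂
    exact leadingCoeff_ne_zero.mpr hf₂0 h₂.symm
  · rw [eC₁, eC₂, eA₁, eA₂]
    ring
  · rw [eC₁, eC₂, eA₁, eA₂]
    ring

/-- **Hyperelliptic Bézout formula.**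
In the hyperelliptic setup with `k ≤ 12`, the determinant of the `2k × 2k` Bézout
matrix `A = [[A¹¹, A¹²],[A²¹, A²²]]` vanishes iff `a+b√f` and `c+d√f` have a common
zero on the hyperelliptic curve `s² = f(t)` (including at infinity).

(Note on indexing: the blocks are defined with 1-indexed `(i,j)`; the 0-based entry
`(i₀,j₀)` of each block is given by the defs above, with `p ≤ min i₀ j₀`
corresponding to `p < min(i,j)` and `p + q = i₀ + j₀ + 1` to `p + q = i + j − 1`.) -/
theorem hyperelliptic_bezout_formula
    {K : Type*} [Field K] [IsAlgClosed K] (hchar : ringChar K ≠ 2)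
    (g k : ℕ) (f f1 f2 a b c d : Polynomial K)
    (hsqf : Squarefree f) (hdegf : f.natDegree = 2 * g + 2)
    (hfact : f = f1 * f2) (hdegf1 : f1.natDegree = g + 1) (hdegf2 : f2.natDegree = g + 1)
    (hk : g + 1 ≤ k) (hk12 : k ≤ 12)
    (hdega : a.natDegree ≤ k) (hdegc : c.natDegree ≤ k)
    (hdegb : b.natDegree ≤ k - (g + 1)) (hdegd : d.natDegree ≤ k - (g + 1))
    (hindep : ∀ lam mu : K, lam • a = mu • c → lam • b = mu • d → lam = 0 ∧ mu = 0) :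
    (heBezoutMatrix k a b c d f1 f2).det = 0
    ↔ (∃ t0 s0 : K, s0 ^ 2 = f.eval t0 ∧
          a.eval t0 + b.eval t0 * s0 = 0 ∧ c.eval t0 + d.eval t0 * s0 = 0) ∨
      (∃ w : K, w ^ 2 = f.coeff (2 * g + 2) ∧
          a.coeff k + w * b.coeff (k - (g + 1)) = 0 ∧
          c.coeff k + w * d.coeff (k - (g + 1)) = 0) := by
  obtain ⟨n, rfl⟩ := Nat.exists_eq_add_of_le' hk
  rw [Nat.add_sub_cancel] at hdegb hdegd ⊢
  have hne : ∀ {p : K[X]}, p.natDegree = g + 1 → p ≠ 0 := by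
    rintro p hp rfl
    simp at hp
  have hmul : ∀ {p q : K[X]}, p.natDegree ≤ n → q.natDegree = g + 1 →
      (p * q).natDegree ≤ n + (g + 1) :=
    fun hp hq => natDegree_mul_le.trans (add_le_add hp hq.le)
  have hlead : f.coeff (2 * g + 2) = f1.coeff (g + 1) * f2.coeff (g + 1) := by
    rw [hfact, show 2 * g + 2 = (g + 1) + (g + 1) by ring,
      coeff_mul_add_eq_of_natDegree_le hdegf1.le hdegf2.le]
  rw [det_heBezoutMatrix_eq_zero_iff hdega hdegc (hmul hdegb hdegf1) (hmul hdegd hdegf1)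
    (hmul hdegb hdegf2) (hmul hdegd hdegf2), hlead]
  constructor
  · rintro ⟨x, y, hx, hy, hxy, h₁, h₂⟩
    by_contra! hno
    exact hxy (eq_zero_of_bezout_eq_zero hdegf1 hdegf2 (hne hdegf2) hdega hdegc hdegb hdegd
      (fun t s hs => hno.1 t s (by rw [hs, hfact])) hno.2 hx hy h₁ h₂)
  · rintro (⟨t, s, hs, hF, hH⟩ | ⟨w, hw, hF, hH⟩)
    · refine exists_bezout_kernel_of_affine_zero (by omega) hdega hdegc (hmul hdegb hdegf1)
        (hmul hdegd hdegf1) (hmul hdegb hdegf2) (hmul hdegd hdegf2) ?_ (hfact ▸ hs) hF hH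
      by_contra! h
      have hdvd : (X - C t) * (X - C t) ∣ f :=
        hfact ▸ mul_dvd_mul (dvd_iff_isRoot.mpr h.1) (dvd_iff_isRoot.mpr h.2)
      exact not_isUnit_X_sub_C t (hsqf _ hdvd)
    · exact exists_bezout_kernel_of_zero_at_infinity (by omega) hdegf1 hdegf2 (hne hdegf2) hdega
        hdegc hdegb hdegd hw hF hH
end
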